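/- arXiv:1307.1809 — 5 statements merged into one kernel-verified Lean document; each statement's English description precedes it below -/
import Mathlib

section
/- Let B ⊆ ℝ³ be open and contractible, and let T be a smooth (²₀)-tensor field on B. Then there exists a smooth (²₀)-tensor field W : B → ℝ^{3×3} with T = curl^T W, i.e. T^{IJ} = ε_{JKL} ∂_K W^{IL} on B for all I, J, if and only if div T = 0 on B, i.e. ∂_J T^{IJ} = 0 on B for all I. -/
/-- Partial derivative in the `K`-th coordinate direction. -/
noncomputable def pd {n : ℕ} (K : Fin n) (f : (Fin n → ℝ) → ℝ) (x : Fin n → ℝ) : ℝ :=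
  fderiv ℝ f x (Pi.single K 1)

/-- The standard permutation symbol `ε_{ijk}` on `Fin 3`. -/
noncomputable def eps (i j k : Fin 3) : ℝ :=
  (((j : ℕ) : ℝ) - ((i : ℕ) : ℝ)) * (((k : ℕ) : ℝ) - ((i : ℕ) : ℝ)) *
    (((k : ℕ) : ℝ) - ((j : ℕ) : ℝ)) / 2

open Set Filter Topology MeasureTheory
open scoped ContDiff Manifold

/-- A continuous positive radius function on an open set, whose balls stay inside the set. -/
theorem IsOpen.exists_continuous_radius {E : Type*} [PseudoMetricSpace E] {B : Set E}
    (hB : IsOpen B) :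
    ∃ r : E → ℝ, Continuous r ∧ ∀ x ∈ B, 0 < r x ∧ Metric.ball x (r x) ⊆ B := by
  rcases (Bᶜ).eq_empty_or_nonempty with h | h
  · refine ⟨fun _ => 1, continuous_const, fun x _ => ⟨one_pos, ?_⟩⟩
    simp [compl_empty_iff.mp h]
  · refine ⟨fun x => Metric.infDist x Bᶜ, Metric.continuous_infDist_pt _, fun x hx => ⟨?_, ?_⟩⟩
    · exact (hB.isClosed_compl.notMem_iff_infDist_pos h).1 (by simpa using hx)
    · exact Metric.ball_infDist_compl_subset

/-- A contractible open set admits a smooth contraction, defined for all times. -/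
theorem IsOpen.exists_smooth_contraction {E : Type*} [NormedAddCommGroup E] [NormedSpace ℝ E]
    [FiniteDimensional ℝ E] {B : Set E} (hB : IsOpen B) [ContractibleSpace B] :
    ∃ (p : E) (G : E × ℝ → E), ContDiffOn ℝ ∞ G (B ×ˢ univ) ∧ MapsTo G (B ×ˢ univ) B ∧
      (∀ x ∈ B, G (x, 0) = x) ∧ ∀ x ∈ B, G (x, 1) = p := by
  classical
  obtain ⟨r, hr, hrB⟩ := hB.exists_continuous_radius
  obtain ⟨p, ⟨H⟩⟩ := id_nullhomotopic B
  let U : TopologicalSpace.Opens (E × ℝ) := ⟨B ×ˢ univ, hB.prod isOpen_univ⟩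
  have hU (z : U) : z.1.1 ∈ B := z.2.1
  let h : U → E := fun z => H (projIcc 0 1 zero_le_one (3 * z.1.2 - 1), ⟨z.1.1, hU z⟩)
  have h_cont : Continuous h := by
    refine continuous_subtype_val.comp (H.continuous.comp (.prodMk ?_ ?_))
    · exact continuous_projIcc.comp (by fun_prop)
    · exact .subtype_mk (by fun_prop) _
  have h_mem (z : U) : h z ∈ B := Subtype.coe_prop _
  have h_left (z : U) (hz : z.1.2 < 1 / 3) : h z = z.1.1 := by
    simp [h, projIcc_of_le_left zero_le_one (show 3 * z.1.2 - 1 ≤ 0 by linarith)]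
  have h_right (z : U) (hz : 2 / 3 < z.1.2) : h z = p := by
    simp [h, projIcc_of_right_le zero_le_one (show 1 ≤ 3 * z.1.2 - 1 by linarith)]
  let t : U → Set E := fun z =>
    if z.1.2 ≤ 0 then {z.1.1} else if 1 ≤ z.1.2 then {p.1} else Metric.ball (h z) (r (h z))
  have ht (z : U) : Convex ℝ (t z) := by
    simp only [t]; split_ifs
    exacts [convex_singleton _, convex_singleton _, convex_ball _ _]
  have h_mem_t (z : U) : h z ∈ t z := by
    simp only [t]; split_ifs with h0 h1
    · exact h_left z (by linarith)
    · exact h_right z (by linarith)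
    · exact Metric.mem_ball_self (hrB _ (h_mem z)).1
  have ht_sub (z : U) : t z ⊆ B := by
    simp only [t]; split_ifs
    exacts [singleton_subset_iff.2 (hU z), singleton_subset_iff.2 p.2, (hrB _ (h_mem z)).2]
  have h_time : Continuous fun z : U => z.1.2 := by fun_prop
  have : LocallyCompactSpace U := U.2.locallyCompactSpace
  obtain ⟨g, hg⟩ := exists_contMDiffMap_forall_mem_convex_of_local (n := ⊤)
      𝓘(ℝ, E × ℝ) ht fun z => by
    rcases lt_or_ge z.1.2 (1 / 3) with hz | hz
    · refine ⟨{y | y.1.2 < 1 / 3}, h_time.continuousAt.eventually_lt_const hz,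
        fun y => y.1.1, ?_, fun y hy => by simpa only [← h_left y hy] using h_mem_t y⟩
      exact (contDiff_fst.contMDiff.comp contMDiff_subtype_val).contMDiffOn
    rcases lt_or_ge (2 / 3) z.1.2 with hz' | hz'
    · exact ⟨{y | 2 / 3 < y.1.2}, h_time.continuousAt.eventually_const_lt hz',
        fun _ => p, contMDiffOn_const, fun y hy => h_right y hy ▸ h_mem_t y⟩
    · have hev : ∀ᶠ y in 𝓝 z, 0 < y.1.2 ∧ y.1.2 < 1 ∧ dist (h z) (h y) < r (h y) := by
        refine (h_time.continuousAt.eventually_const_lt (by linarith)).and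
          ((h_time.continuousAt.eventually_lt_const (by linarith)).and
            ((continuous_const.dist h_cont).continuousAt.eventually_lt
              (hr.comp h_cont).continuousAt ?_))
        simpa using (hrB _ (h_mem z)).1
      refine ⟨_, hev, fun _ => h z, contMDiffOn_const, ?_⟩
      rintro y ⟨hy0, hy1, hy⟩
      simpa [t, hy0.not_ge, hy1.not_ge] using hy
  have hG (z : U) : (fun z => if hz : z ∈ U then g ⟨z, hz⟩ else 0 : E × ℝ → E) z = g z := by simp
  refine ⟨p, fun z => if hz : z ∈ U then g ⟨z, hz⟩ else 0, fun z hz => ?_, fun z hz => ?_,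
    fun x hx => ?_, fun x hx => ?_⟩
  · refine ContDiffAt.contDiffWithinAt (contMDiffAt_iff_contDiffAt.1 ?_)
    refine (contMDiffAt_subtype_iff (U := U) (x := ⟨z, hz⟩)).1 ?_
    simpa only [hG] using! g.contMDiff.contMDiffAt
  · rw [hG ⟨z, hz⟩]
    exact ht_sub _ (hg _)
  · rw [hG ⟨(x, 0), hx, trivial⟩]
    simpa [t] using hg ⟨(x, 0), hx, trivial⟩
  · rw [hG ⟨(x, 1), hx, trivial⟩]
    simpa [t, (one_pos (α := ℝ)).not_ge] using hg ⟨(x, 1), hx, trivial⟩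

theorem ContinuousOn.continuous_slice {X Y Z : Type*} [TopologicalSpace X] [TopologicalSpace Y]
    [TopologicalSpace Z] {s : Set X} {f : X × Y → Z} (hf : ContinuousOn f (s ×ˢ univ)) {x : X}
    (hx : x ∈ s) : Continuous fun t => f (x, t) :=
  hf.comp_continuous (by fun_prop) fun _ => ⟨hx, trivial⟩

section ParametricIntegral

universe u

variable {E F : Type u} [NormedAddCommGroup E] [NormedSpace ℝ E] [FiniteDimensional ℝ E]
  [NormedAddCommGroup F] [NormedSpace ℝ F] {s : Set E} {f : E × ℝ → F}

theorem hasFDerivAt_intervalIntegral_of_contDiffOn (hs : IsOpen s)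
    (hf : ContDiffOn ℝ 1 f (s ×ˢ univ)) (a b : ℝ) {x : E} (hx : x ∈ s) :
    HasFDerivAt (fun x => ∫ t in a..b, f (x, t))
      (∫ t in a..b, (fderiv ℝ f (x, t)).comp (.inl ℝ E ℝ)) x := by
  have hs' : IsOpen (s ×ˢ (univ : Set ℝ)) := hs.prod isOpen_univ
  have hd : ContinuousOn (fun z => (fderiv ℝ f z).comp (.inl ℝ E ℝ)) (s ×ˢ univ) :=
    (hf.continuousOn_fderiv_of_isOpen hs' le_rfl).clm_comp continuousOn_const
  have := FiniteDimensional.proper ℝ E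
  obtain ⟨δ, hδ, hδs⟩ := Metric.nhds_basis_closedBall.mem_iff.1 (hs.mem_nhds hx)
  obtain ⟨C, hC⟩ := ((isCompact_closedBall x δ).prod (isCompact_uIcc (a := a)
    (b := b))).exists_bound_of_continuousOn (hd.mono (prod_mono hδs (subset_univ _)))
  refine intervalIntegral.hasFDerivAt_integral_of_dominated_of_fderiv_le (bound := fun _ => C)
    (F' := fun x t => (fderiv ℝ f (x, t)).comp (.inl ℝ E ℝ))
    (Metric.closedBall_mem_nhds x hδ) ?_ ?_ ?_ ?_ ?_ ?_
  · filter_upwards [hs.mem_nhds hx] with y hy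
    exact (hf.continuousOn.continuous_slice hy).aestronglyMeasurable
  · exact (hf.continuousOn.continuous_slice hx).intervalIntegrable _ _
  · exact (hd.continuous_slice hx).aestronglyMeasurable
  · exact .of_forall fun t ht y hy => hC (y, t) ⟨hy, uIoc_subset_uIcc ht⟩
  · exact intervalIntegrable_const
  · refine .of_forall fun t _ y hy => ?_
    have hyt : (y, t) ∈ s ×ˢ (univ : Set ℝ) := ⟨hδs hy, trivial⟩
    exact ((hf.differentiableOn one_ne_zero).differentiableAt (hs'.mem_nhds hyt)).hasFDerivAt.comp y
      (hasFDerivAt_prodMk_left y t)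

theorem fderiv_intervalIntegral_apply_of_contDiffOn (hs : IsOpen s)
    (hf : ContDiffOn ℝ 1 f (s ×ˢ univ)) (a b : ℝ) {x : E} (hx : x ∈ s) (v : E) :
    fderiv ℝ (fun x => ∫ t in a..b, f (x, t)) x v = ∫ t in a..b, fderiv ℝ f (x, t) (v, 0) := by
  rw [(hasFDerivAt_intervalIntegral_of_contDiffOn hs hf a b hx).fderiv,
    ContinuousLinearMap.intervalIntegral_apply]
  · simp
  · have hd : ContinuousOn (fun z => (fderiv ℝ f z).comp (.inl ℝ E ℝ)) (s ×ˢ univ) :=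
      (hf.continuousOn_fderiv_of_isOpen (hs.prod isOpen_univ) le_rfl).clm_comp continuousOn_const
    exact (hd.continuous_slice hx).intervalIntegrable _ _

theorem contDiffOn_intervalIntegral (hs : IsOpen s) (hf : ContDiffOn ℝ ∞ f (s ×ˢ univ))
    (a b : ℝ) : ContDiffOn ℝ ∞ (fun x => ∫ t in a..b, f (x, t)) s := by
  refine contDiffOn_infty.2 fun n => ?_
  induction n generalizing F with
  | zero =>
    refine contDiffOn_zero.2 fun x hx => ?_
    exact (hasFDerivAt_intervalIntegral_of_contDiffOn hs (hf.of_le (by simp)) a b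
      hx).continuousAt.continuousWithinAt
  | succ n ih =>
    have hd {x : E} (hx : x ∈ s) := hasFDerivAt_intervalIntegral_of_contDiffOn hs
      (hf.of_le (by simp)) a b hx
    push_cast
    refine (contDiffOn_succ_iff_fderiv_of_isOpen hs).2
      ⟨fun x hx => (hd hx).differentiableAt.differentiableWithinAt, by simp, ?_⟩
    refine ContDiffOn.congr (ih (f := fun z => (fderiv ℝ f z).comp (.inl ℝ E ℝ)) ?_)
      fun x hx => (hd hx).fderiv
    exact (hf.fderiv_of_isOpen (hs.prod isOpen_univ) (by simp)).clm_comp contDiffOn_const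

end ParametricIntegral

section Flux

/-- The scalar triple product of three vectors of `ℝ³`. -/
def tripleProduct (u v w : Fin 3 → ℝ) : ℝ :=
  u 0 * (v 1 * w 2 - v 2 * w 1) + u 1 * (v 2 * w 0 - v 0 * w 2) + u 2 * (v 0 * w 1 - v 1 * w 0)

/-- The pullback along `G` of the flux `2`-form of the vector field `v`, evaluated at the
constant vector fields `a` and `b`. -/
noncomputable def pullbackFlux {V : Type*} [NormedAddCommGroup V] [NormedSpace ℝ V]
    (v : (Fin 3 → ℝ) → Fin 3 → ℝ) (G : V → Fin 3 → ℝ) (a b z : V) : ℝ :=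
  tripleProduct (v (G z)) (fderiv ℝ G z a) (fderiv ℝ G z b)

variable {V : Type*} [NormedAddCommGroup V] [NormedSpace ℝ V]

theorem ContDiffOn.tripleProduct {n : ℕ∞ω} {s : Set V} {u v w : V → Fin 3 → ℝ}
    (hu : ContDiffOn ℝ n u s) (hv : ContDiffOn ℝ n v s) (hw : ContDiffOn ℝ n w s) :
    ContDiffOn ℝ n (fun z => tripleProduct (u z) (v z) (w z)) s := by
  rw [contDiffOn_pi] at hu hv hw
  have h (i j k : Fin 3) : ContDiffOn ℝ n (fun z => u z i * (v z j * w z k - v z k * w z j)) s :=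
    (hu i).mul (((hv j).mul (hw k)).sub ((hv k).mul (hw j)))
  exact ((h 0 1 2).add (h 1 2 0)).add (h 2 0 1)

theorem fderiv_tripleProduct_apply {u v w : V → Fin 3 → ℝ} {z : V} (hu : DifferentiableAt ℝ u z)
    (hv : DifferentiableAt ℝ v z) (hw : DifferentiableAt ℝ w z) (c : V) :
    fderiv ℝ (fun z => tripleProduct (u z) (v z) (w z)) z c =
      tripleProduct (fderiv ℝ u z c) (v z) (w z) + tripleProduct (u z) (fderiv ℝ v z c) (w z) +
        tripleProduct (u z) (v z) (fderiv ℝ w z c) := by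
  have hu' := hasFDerivAt_pi'.1 hu.hasFDerivAt
  have hv' := hasFDerivAt_pi'.1 hv.hasFDerivAt
  have hw' := hasFDerivAt_pi'.1 hw.hasFDerivAt
  have h (i j k : Fin 3) :=
    (hu' i).mul (((hv' j).mul (hw' k)).sub ((hv' k).mul (hw' j)))
  have key := (((h 0 1 2).add (h 1 2 0)).add (h 2 0 1)).fderiv
  refine (congrArg (· c) key).trans ?_
  simp [tripleProduct]
  ring

theorem tripleProduct_map_cyclic (A : (Fin 3 → ℝ) →L[ℝ] Fin 3 → ℝ)
    (hA : ∑ J, A (Pi.single J 1) J = 0) (a b c : Fin 3 → ℝ) :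
    tripleProduct (A a) b c + tripleProduct (A b) c a + tripleProduct (A c) a b = 0 := by
  obtain ⟨M, hM⟩ : ∃ M : Fin 3 → Fin 3 → ℝ, ∀ k, A (Pi.single k 1) = M k := ⟨_, fun _ => rfl⟩
  have h (u : Fin 3 → ℝ) (i : Fin 3) : A u i = ∑ k, u k * M k i := by
    conv_lhs => rw [pi_eq_sum_univ' u]
    simp [map_sum, Finset.sum_apply, hM]
  simp only [hM, Fin.sum_univ_three] at h hA
  simp only [tripleProduct, h]
  linear_combination (a 0 * (b 1 * c 2 - b 2 * c 1) + a 1 * (b 2 * c 0 - b 0 * c 2) +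
    a 2 * (b 0 * c 1 - b 1 * c 0)) * hA

theorem fderiv_pullbackFlux_cyclic {v : (Fin 3 → ℝ) → Fin 3 → ℝ} {G : V → Fin 3 → ℝ} {z : V}
    (hG : ContDiffAt ℝ 2 G z) (hv : DifferentiableAt ℝ v (G z))
    (hdiv : ∑ J, pd J (fun y => v y J) (G z) = 0) (a b c : V) :
    fderiv ℝ (pullbackFlux v G b c) z a + fderiv ℝ (pullbackFlux v G c a) z b +
      fderiv ℝ (pullbackFlux v G a b) z c = 0 := by
  have hG1 : DifferentiableAt ℝ G z := hG.differentiableAt two_ne_zero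
  have hG2 : DifferentiableAt ℝ (fderiv ℝ G) z :=
    (hG.fderiv_right (m := 1) (by norm_num)).differentiableAt one_ne_zero
  have hGa (a : V) : DifferentiableAt ℝ (fun z => fderiv ℝ G z a) z :=
    hG2.clm_apply (differentiableAt_const _)
  have hGa' (a b : V) : fderiv ℝ (fun z => fderiv ℝ G z a) z b = fderiv ℝ (fderiv ℝ G) z b a := by
    rw [fderiv_clm_apply hG2 (differentiableAt_const _)]
    simp
  have hsymm (a b : V) := hG.isSymmSndFDerivAt (by simp) a b
  have hvG (a : V) : fderiv ℝ (fun z => v (G z)) z a = fderiv ℝ v (G z) (fderiv ℝ G z a) := by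
    rw [show (fun z => v (G z)) = v ∘ G from rfl, fderiv_comp z hv hG1]
    rfl
  have htr : ∑ J, fderiv ℝ v (G z) (Pi.single J 1) J = 0 := by
    simpa [pd, fderiv_apply hv] using hdiv
  have key := tripleProduct_map_cyclic _ htr (fderiv ℝ G z a) (fderiv ℝ G z b) (fderiv ℝ G z c)
  have hd (a b c : V) := fderiv_tripleProduct_apply (hv.comp z hG1) (hGa a) (hGa b) c
  simp only [Function.comp_def, hGa', hvG] at hd
  unfold pullbackFlux
  rw [hd, hd, hd, hsymm b a, hsymm c a, hsymm c b]
  simp only [tripleProduct] at key ⊢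
  linear_combination key

theorem exists_curl_eq_of_div_eq_zero {B : Set (Fin 3 → ℝ)} (hB : IsOpen B) [ContractibleSpace B]
    {v : (Fin 3 → ℝ) → Fin 3 → ℝ} (hv : ContDiffOn ℝ ∞ v B)
    (hdiv : ∀ x ∈ B, ∑ J, pd J (fun y => v y J) x = 0) :
    ∃ w : (Fin 3 → ℝ) → Fin 3 → ℝ, ContDiffOn ℝ ∞ w B ∧
      ∀ x ∈ B, ∀ J, v x J = ∑ K, ∑ L, eps J K L * pd K (fun y => w y L) x := by
  obtain ⟨p, G, hG, hGB, hG0, hG1⟩ := hB.exists_smooth_contraction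
  let e (K : Fin 3) : (Fin 3 → ℝ) × ℝ := (Pi.single K 1, 0)
  let τ : (Fin 3 → ℝ) × ℝ := (0, 1)
  have hs : IsOpen (B ×ˢ (univ : Set ℝ)) := hB.prod isOpen_univ
  have hflux (a b) : ContDiffOn ℝ ∞ (pullbackFlux v G a b) (B ×ˢ univ) := by
    have hD := hG.fderiv_of_isOpen (m := ∞) hs (by simp)
    exact (hv.comp hG hGB).tripleProduct (hD.clm_apply contDiffOn_const)
      (hD.clm_apply contDiffOn_const)
  have hpd {x} (hx : x ∈ B) (K L : Fin 3) :
      pd K (fun y => -∫ t in (0 : ℝ)..1, pullbackFlux v G τ (e L) (y, t)) x =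
        -∫ t in (0 : ℝ)..1, fderiv ℝ (pullbackFlux v G τ (e L)) (x, t) (e K) := by
    rw [← fderiv_intervalIntegral_apply_of_contDiffOn hB ((hflux τ (e L)).of_le (by simp)) 0 1 hx]
    simp [pd]
  refine ⟨fun x L => -∫ t in (0 : ℝ)..1, pullbackFlux v G τ (e L) (x, t),
    contDiffOn_pi.2 fun L => (contDiffOn_intervalIntegral hB (hflux τ (e L)) 0 1).neg,
    fun x hx J => ?_⟩
  have hmem (t : ℝ) : (x, t) ∈ B ×ˢ (univ : Set ℝ) := ⟨hx, trivial⟩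
  have hcont (a b c) : Continuous fun t => fderiv ℝ (pullbackFlux v G a b) (x, t) c :=
    (((hflux a b).continuousOn_fderiv_of_isOpen hs (by simp)).clm_apply
      continuousOn_const).continuous_slice hx
  have hGe (K : Fin 3) (t : ℝ) : fderiv ℝ G (x, t) (e K) =
      fderiv ℝ (fun y => G (y, t)) x (Pi.single K 1) := by
    have hd := ((hG.contDiffAt (hs.mem_nhds (hmem t))).differentiableAt (by simp)).hasFDerivAt.comp
      (f := fun y => (y, t)) x (hasFDerivAt_prodMk_left x t)
    exact (congrArg (· (Pi.single K 1)) hd.fderiv).symm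
  have hGe0 (K : Fin 3) : fderiv ℝ G (x, 0) (e K) = Pi.single K 1 := by
    have : (fun y => G (y, 0)) =ᶠ[𝓝 x] id := by
      filter_upwards [hB.mem_nhds hx] with y hy using hG0 y hy
    rw [hGe, this.fderiv_eq, fderiv_id]
    rfl
  have hGe1 (K : Fin 3) : fderiv ℝ G (x, 1) (e K) = 0 := by
    have : (fun y => G (y, 1)) =ᶠ[𝓝 x] fun _ => p := by
      filter_upwards [hB.mem_nhds hx] with y hy using hG1 y hy
    rw [hGe, this.fderiv_eq]
    simp
  have key (K L : Fin 3) :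
      (∫ t in (0 : ℝ)..1, fderiv ℝ (pullbackFlux v G τ (e L)) (x, t) (e K)) -
        ∫ t in (0 : ℝ)..1, fderiv ℝ (pullbackFlux v G τ (e K)) (x, t) (e L) =
      -tripleProduct (v x) (Pi.single K 1) (Pi.single L 1) := by
    have hneg : pullbackFlux v G (e L) τ = -pullbackFlux v G τ (e L) := by
      ext z
      simp only [pullbackFlux, tripleProduct, Pi.neg_apply]
      ring
    have hclosed (t : ℝ) : fderiv ℝ (pullbackFlux v G τ (e L)) (x, t) (e K) -
        fderiv ℝ (pullbackFlux v G τ (e K)) (x, t) (e L) =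
        fderiv ℝ (pullbackFlux v G (e K) (e L)) (x, t) τ := by
      have := fderiv_pullbackFlux_cyclic
        ((hG.contDiffAt (hs.mem_nhds (hmem t))).of_le ENat.LEInfty.out)
        ((hv.contDiffAt (hB.mem_nhds (hGB (hmem t)))).differentiableAt (by simp))
        (hdiv _ (hGB (hmem t))) τ (e K) (e L)
      rw [hneg, fderiv_neg] at this
      simp only [_root_.neg_apply] at this
      linarith
    rw [← intervalIntegral.integral_sub ((hcont _ _ _).intervalIntegrable _ _)
      ((hcont _ _ _).intervalIntegrable _ _)]
    simp only [hclosed]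
    rw [intervalIntegral.integral_eq_sub_of_hasDerivAt
      (f := fun t => pullbackFlux v G (e K) (e L) (x, t)) (fun t _ => ?_)
      ((hcont _ _ _).intervalIntegrable _ _)]
    · simp only [pullbackFlux, hGe0, hGe1, hG0 x hx]
      simp [tripleProduct]
    · exact (((hflux (e K) (e L)).contDiffAt (hs.mem_nhds (hmem t))).differentiableAt
        (by simp)).hasFDerivAt.comp_hasDerivAt t ((hasDerivAt_const t x).prodMk (hasDerivAt_id t))
  simp only [hpd hx]
  have h01 := key 0 1
  have h12 := key 1 2
  have h20 := key 2 0
  simp [tripleProduct] at h01 h12 h20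
  fin_cases J <;> simp [Fin.sum_univ_three, eps] <;> linarith

theorem div_curl_eq_zero {w : (Fin 3 → ℝ) → Fin 3 → ℝ} {x : Fin 3 → ℝ}
    (hw : ContDiffAt ℝ 2 w x) :
    ∑ J, pd J (fun y => ∑ K, ∑ L, eps J K L * pd K (fun y => w y L) y) x = 0 := by
  have hc (L : Fin 3) : ContDiffAt ℝ 2 (fun y => w y L) x := contDiffAt_pi.1 hw L
  have hd (L : Fin 3) : DifferentiableAt ℝ (fderiv ℝ fun y => w y L) x :=
    ((hc L).fderiv_right (m := 1) (by norm_num)).differentiableAt one_ne_zero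
  have hda (K L : Fin 3) : DifferentiableAt ℝ (pd K fun y => w y L) x :=
    (hd L).clm_apply (differentiableAt_const _)
  have hsymm (J K L : Fin 3) : pd J (pd K fun y => w y L) x = pd K (pd J fun y => w y L) x := by
    have h (J K : Fin 3) : pd J (pd K fun y => w y L) x =
        fderiv ℝ (fderiv ℝ fun y => w y L) x (Pi.single J 1) (Pi.single K 1) := by
      unfold pd
      rw [fderiv_clm_apply (hd L) (differentiableAt_const _)]
      simp
    rw [h, h, (hc L).isSymmSndFDerivAt (by simp)]
  have hpd (J : Fin 3) : pd J (fun y => ∑ K, ∑ L, eps J K L * pd K (fun y => w y L) y) x =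
      ∑ K, ∑ L, eps J K L * pd J (pd K fun y => w y L) x := by
    have h := HasFDerivAt.fun_sum (u := Finset.univ) fun K _ =>
      HasFDerivAt.fun_sum (u := Finset.univ) fun L _ =>
        (hda K L).hasFDerivAt.const_mul (eps J K L)
    rw [pd, h.fderiv]
    simp [pd]
  simp only [hpd]
  simp [Fin.sum_univ_three, eps]
  linear_combination hsymm 0 1 2 + hsymm 2 0 1 + hsymm 1 2 0

end Flux

/-- On an open contractible `B ⊆ ℝ³`, a smooth (²₀)-tensor field `T` admits a
`curlᵀ`-potential `W` (i.e. `T^{IJ} = ε_{JKL} ∂_K W^{IL}`) iff `div T = 0`. -/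
theorem curlT_potential_iff_contractible_3d
    (B : Set (Fin 3 → ℝ)) (hB : IsOpen B) (hc : ContractibleSpace B)
    (T : (Fin 3 → ℝ) → Fin 3 → Fin 3 → ℝ)
    (hT : ContDiffOn ℝ (⊤ : ℕ∞) T B) :
    (∃ W : (Fin 3 → ℝ) → Fin 3 → Fin 3 → ℝ,
        ContDiffOn ℝ (⊤ : ℕ∞) W B ∧
        ∀ x ∈ B, ∀ I J, T x I J = ∑ K, ∑ L, eps J K L * pd K (fun y => W y I L) x) ↔
      (∀ x ∈ B, ∀ I, (∑ J, pd J (fun y => T y I J) x) = 0) := by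
  constructor
  · rintro ⟨W, hW, hTW⟩ x hx I
    rw [← div_curl_eq_zero (w := fun y => W y I) (x := x)
      (((contDiffOn_pi.1 hW I).contDiffAt (hB.mem_nhds hx)).of_le ENat.LEInfty.out)]
    refine Finset.sum_congr rfl fun J _ => ?_
    have : (fun y => T y I J) =ᶠ[𝓝 x]
        fun y => ∑ K, ∑ L, eps J K L * pd K (fun y => W y I L) y := by
      filter_upwards [hB.mem_nhds hx] with y hy using hTW y hy I J
    rw [pd, pd, this.fderiv_eq]
  · intro hdiv
    choose w hw hcurl using fun I => exists_curl_eq_of_div_eq_zero hB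
      (contDiffOn_pi.1 hT I) fun x hx => hdiv x hx I
    exact ⟨fun x I => w I x, contDiffOn_pi.2 hw, fun x hx I J => hcurl I x hx J⟩
end

section
/- Let B ⊆ ℝⁿ be open and connected, and let U : B → ℝⁿ be a smooth vector field satisfying the Killing equation ∂_J U^I + ∂_I U^J = 0 on B for all I, J ∈ {1,…,n}. Then there exist a vector v ∈ ℝⁿ and a skew-symmetric matrix A ∈ ℝ^{n×n} (A + Aᵀ = 0) such that U(X) = v + A·X for all X ∈ B. -/
open Matrix

/-- A tensor symmetric in its first two indices and skew-symmetric in its last two vanishes. -/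
lemma eq_zero_of_symm_of_skew {ι : Type*} {T : ι → ι → ι → ℝ}
    (hsymm : ∀ i j k, T i j k = T j i k) (hskew : ∀ i j k, T i j k + T i k j = 0)
    (i j k : ι) : T i j k = 0 := by
  linarith [hsymm i j k, hskew j i k, hsymm j k i, hskew k j i, hsymm k i j, hskew i k j]

lemma pd_eq_fderiv_apply {n : ℕ} {U : (Fin n → ℝ) → Fin n → ℝ} {x : Fin n → ℝ}
    (hU : DifferentiableAt ℝ U x) (I J : Fin n) :
    pd J (fun y => U y I) x = fderiv ℝ U x (Pi.single J 1) I := by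
  rw [pd, (hasFDerivAt_pi'.1 hU.hasFDerivAt I).fderiv]
  rfl

/-- The second derivative of a `C²` Killing vector field vanishes. -/
lemma fderiv_fderiv_eq_zero_of_killing {n : ℕ} {B : Set (Fin n → ℝ)} (hB : IsOpen B)
    {U : (Fin n → ℝ) → Fin n → ℝ} (hU : ContDiffOn ℝ 2 U B)
    (hKilling : ∀ x ∈ B, ∀ I J,
      pd J (fun y => U y I) x + pd I (fun y => U y J) x = 0)
    {x : Fin n → ℝ} (hx : x ∈ B) : fderiv ℝ (fderiv ℝ U) x = 0 := by
  have hUx : ContDiffAt ℝ 2 U x := hU.contDiffAt (hB.mem_nhds hx)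
  have hsymm : IsSymmSndFDerivAt ℝ U x := hUx.isSymmSndFDerivAt (by simp)
  have hF : HasFDerivAt (fderiv ℝ U) (fderiv ℝ (fderiv ℝ U) x) x :=
    ((hUx.fderiv_right (m := 1) (by norm_num)).differentiableAt (by norm_num)).hasFDerivAt
  have hentry (I J : Fin n) : HasFDerivAt (fun y => fderiv ℝ U y (Pi.single J 1) I)
      ((ContinuousLinearMap.proj I).comp
        ((fderiv ℝ (fderiv ℝ U) x).flip (Pi.single J 1))) x := by
    let E : ((Fin n → ℝ) →L[ℝ] Fin n → ℝ) →L[ℝ] ℝ := (ContinuousLinearMap.proj I).comp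
      (ContinuousLinearMap.apply ℝ (Fin n → ℝ) (Pi.single J 1))
    exact E.hasFDerivAt.comp x hF
  have hskew (K J I : Fin n) :
      fderiv ℝ (fderiv ℝ U) x (Pi.single K 1) (Pi.single J 1) I +
        fderiv ℝ (fderiv ℝ U) x (Pi.single K 1) (Pi.single I 1) J = 0 := by
    have hzero : (fun y => fderiv ℝ U y (Pi.single J 1) I + fderiv ℝ U y (Pi.single I 1) J)
        =ᶠ[nhds x] fun _ => 0 := by
      filter_upwards [hB.mem_nhds hx] with y hy
      have hUy : DifferentiableAt ℝ U y :=
        (hU.contDiffAt (hB.mem_nhds hy)).differentiableAt (by norm_num)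
      rw [← pd_eq_fderiv_apply hUy, ← pd_eq_fderiv_apply hUy]
      exact hKilling y hy I J
    have h := ((hentry I J).add (hentry J I)).unique
      ((hasFDerivAt_const (0 : ℝ) x).congr_of_eventuallyEq hzero)
    exact DFunLike.congr_fun h (Pi.single K 1)
  have hT := eq_zero_of_symm_of_skew
    (T := fun K J I => fderiv ℝ (fderiv ℝ U) x (Pi.single K 1) (Pi.single J 1) I)
    (fun K J I => congrFun (hsymm.eq (Pi.single K 1) (Pi.single J 1)) I) hskew
  apply ContinuousLinearMap.coe_injective
  refine LinearMap.pi_ext' fun K => LinearMap.ext_ring ?_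
  apply ContinuousLinearMap.coe_injective
  refine LinearMap.pi_ext' fun J => LinearMap.ext_ring ?_
  funext I
  exact hT K J I

/-- Every smooth Killing vector field of the Euclidean metric on an open connected
`B ⊆ ℝⁿ` has the form `U(X) = v + A·X` with `A` skew-symmetric. -/
theorem killing_field_is_affine
    (n : ℕ) (B : Set (Fin n → ℝ)) (hB : IsOpen B) (hBconn : IsConnected B)
    (U : (Fin n → ℝ) → Fin n → ℝ)
    (hU : ContDiffOn ℝ (⊤ : ℕ∞) U B)
    (hKilling : ∀ x ∈ B, ∀ I J,
      pd J (fun y => U y I) x + pd I (fun y => U y J) x = 0) :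
    ∃ (v : Fin n → ℝ) (A : Matrix (Fin n) (Fin n) ℝ),
      A + Aᵀ = 0 ∧ ∀ x ∈ B, U x = v + A.mulVec x := by
  have hU₂ : ContDiffOn ℝ 2 U B := hU.of_le (WithTop.coe_le_coe.2 (le_top : (2 : ℕ∞) ≤ ⊤))
  have hUdiff : DifferentiableOn ℝ U B := hU₂.differentiableOn (by norm_num)
  have hFdiff : DifferentiableOn ℝ (fderiv ℝ U) B :=
    (hU₂.fderiv_of_isOpen (m := 1) hB (by norm_num)).differentiableOn (by norm_num)
  obtain ⟨L, hL⟩ := hB.exists_is_const_of_fderiv_eq_zero hBconn.isPreconnected hFdiff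
    fun x hx => fderiv_fderiv_eq_zero_of_killing hB hU₂ hKilling hx
  obtain ⟨v, hv⟩ := hB.exists_eq_add_of_fderiv_eq hBconn.isPreconnected hUdiff
    L.differentiable.differentiableOn fun x hx => by rw [hL x hx, L.fderiv]
  refine ⟨v, LinearMap.toMatrix' (L : (Fin n → ℝ) →ₗ[ℝ] Fin n → ℝ), ?_, fun x hx => ?_⟩
  · obtain ⟨x, hx⟩ := hBconn.nonempty
    have hUx := hUdiff.differentiableAt (hB.mem_nhds hx)
    ext I J
    have h := hKilling x hx I J
    rw [pd_eq_fderiv_apply hUx, pd_eq_fderiv_apply hUx, hL x hx] at h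
    simpa [LinearMap.toMatrix'_apply, ← Pi.single_apply] using h
  · rw [LinearMap.toMatrix'_mulVec, add_comm]
    exact hv hx
end

section
/- Let B ⊆ ℝⁿ be open, connected and nonempty. Then the space Θ(B) = {U : B → ℝⁿ smooth : ∂_J U^I + ∂_I U^J = 0 on B for all I, J} of Killing vector fields on B is a real vector space of dimension n(n+1)/2. -/
/-- Indices for the coordinates of a Killing field: one translation for each axis and one
rotation for each coordinate plane. -/
abbrev KillingIndex (n : ℕ) : Type :=
  Fin n ⊕ {p : Fin n × Fin n // p.1 < p.2}

theorem card_killingIndex (n : ℕ) : Fintype.card (KillingIndex n) = n * (n + 1) / 2 := by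
  have hlt : Fintype.card {p : Fin n × Fin n // p.1 < p.2} = n * (n - 1) / 2 := by
    rw [Fintype.card_subtype, Finset.card_filter, Fintype.sum_prod_type_right]
    simp_rw [← Finset.card_filter]
    have h (j : Fin n) : (Finset.univ.filter fun i : Fin n => i < j).card = (j : ℕ) := by
      rw [← Fin.card_Iio j]
      congr 1
      ext i
      simp
    simp_rw [h]
    rw [Fin.sum_univ_eq_sum_range (fun i => i) n, Finset.sum_range_id]
  rw [Fintype.card_sum, Fintype.card_fin, hlt]
  rcases n with _ | m
  · rfl
  · rw [Nat.add_sub_cancel, add_comm, ← Nat.add_mul_div_left _ _ two_pos]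
    congr 1
    ring

/-- The skew-symmetric matrix with prescribed entries above the diagonal. -/
def skewOfUpper {n : ℕ} (c : KillingIndex n → ℝ) (I J : Fin n) : ℝ :=
  if h : I < J then c (Sum.inr ⟨(I, J), h⟩)
  else if h : J < I then -c (Sum.inr ⟨(J, I), h⟩) else 0

theorem skewOfUpper_add_swap {n : ℕ} (c : KillingIndex n → ℝ) (I J : Fin n) :
    skewOfUpper c I J + skewOfUpper c J I = 0 := by
  rcases lt_trichotomy I J with h | rfl | h
  · simp [skewOfUpper, h, h.not_gt]
  · simp [skewOfUpper]
  · simp [skewOfUpper, h, h.not_gt]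

theorem skewOfUpper_eq_of_skew {n : ℕ} {c : KillingIndex n → ℝ} {A : Fin n → Fin n → ℝ}
    (hA : ∀ I J, A I J + A J I = 0)
    (hc : ∀ p : {p : Fin n × Fin n // p.1 < p.2}, c (Sum.inr p) = A p.1.1 p.1.2)
    (I J : Fin n) : skewOfUpper c I J = A I J := by
  have := hA I J
  unfold skewOfUpper
  split_ifs with h h'
  · exact hc _
  · rw [hc]
    linarith
  · obtain rfl : I = J := le_antisymm (not_lt.mp h') (not_lt.mp h)
    linarith

/-- The affine vector field with given translation part and skew-symmetric linear part,
as a linear function of the coordinates of these parts. -/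
def affineKillingField (n : ℕ) :
    (KillingIndex n → ℝ) →ₗ[ℝ] (Fin n → ℝ) → Fin n → ℝ where
  toFun c x I := c (Sum.inl I) + ∑ J, skewOfUpper c I J * x J
  map_add' c d := by
    ext x I
    have h (J : Fin n) : skewOfUpper (c + d) I J = skewOfUpper c I J + skewOfUpper d I J := by
      unfold skewOfUpper
      split_ifs <;> simp [add_comm]
    simp only [h, Pi.add_apply, add_mul, Finset.sum_add_distrib]
    ring
  map_smul' a c := by
    ext x I
    have h (J : Fin n) : skewOfUpper (a • c) I J = a * skewOfUpper c I J := by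
      unfold skewOfUpper
      split_ifs <;> simp
    simp only [h, Pi.smul_apply, smul_eq_mul, RingHom.id_apply, mul_add, Finset.mul_sum,
      mul_assoc]

theorem affineKillingField_apply {n : ℕ} (c : KillingIndex n → ℝ) (x : Fin n → ℝ)
    (I : Fin n) :
    affineKillingField n c x I = c (Sum.inl I) + ∑ J, skewOfUpper c I J * x J := rfl

theorem contDiff_affineKillingField {n : ℕ} (c : KillingIndex n → ℝ) {m : WithTop ℕ∞} :
    ContDiff ℝ m (affineKillingField n c) := by
  rw [contDiff_pi]
  intro I
  simp only [affineKillingField_apply]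
  fun_prop

theorem pd_affineKillingField {n : ℕ} (c : KillingIndex n → ℝ) (I J : Fin n)
    (x : Fin n → ℝ) :
    pd J (fun y => affineKillingField n c y I) x = skewOfUpper c I J := by
  have h : HasFDerivAt (fun y => affineKillingField n c y I)
      (∑ K, skewOfUpper c I K • ContinuousLinearMap.proj (R := ℝ) (φ := fun _ : Fin n => ℝ) K)
      x := by
    simp only [affineKillingField_apply]
    refine HasFDerivAt.const_add _ (HasFDerivAt.fun_sum fun K _ => ?_)
    exact (hasFDerivAt_apply K x).const_mul _
  rw [pd, h.fderiv]
  simp [Pi.single_apply]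

theorem fderiv_eq_of_pd_eq {n : ℕ} {f g : (Fin n → ℝ) → ℝ} {x : Fin n → ℝ}
    (h : ∀ J, pd J f x = pd J g x) : fderiv ℝ f x = fderiv ℝ g x := by
  refine ContinuousLinearMap.coe_injective (LinearMap.pi_ext' fun J => ?_)
  ext
  exact h J

theorem pd_pd_eq {n : ℕ} {f : (Fin n → ℝ) → ℝ} {x : Fin n → ℝ} (hf : ContDiffAt ℝ 2 f x)
    (J K : Fin n) :
    pd K (pd J f) x = fderiv ℝ (fderiv ℝ f) x (Pi.single K 1) (Pi.single J 1) := by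
  have hd : DifferentiableAt ℝ (fderiv ℝ f) x :=
    (hf.fderiv_right (m := 1) (by norm_num)).differentiableAt (by norm_num)
  have h : HasFDerivAt (pd J f) _ x := hd.hasFDerivAt.clm_apply (hasFDerivAt_const _ x)
  rw [pd, h.fderiv]
  simp

theorem pd_comm {n : ℕ} {f : (Fin n → ℝ) → ℝ} {x : Fin n → ℝ} (hf : ContDiffAt ℝ 2 f x)
    (J K : Fin n) : pd K (pd J f) x = pd J (pd K f) x := by
  rw [pd_pd_eq hf, pd_pd_eq hf]
  exact (hf.isSymmSndFDerivAt (by simp)).eq _ _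

theorem differentiableAt_pd {n : ℕ} {f : (Fin n → ℝ) → ℝ} {x : Fin n → ℝ}
    (hf : ContDiffAt ℝ 2 f x) (J : Fin n) : DifferentiableAt ℝ (pd J f) x :=
  ((hf.fderiv_right (m := 1) (by norm_num)).differentiableAt (by norm_num)).clm_apply
    (differentiableAt_const _)

/-- The second partial derivatives of a Killing field vanish. -/
theorem pd_pd_eq_zero_of_killing {n : ℕ} {B : Set (Fin n → ℝ)} (hB : IsOpen B)
    {V : (Fin n → ℝ) → Fin n → ℝ} (hV : ∀ x ∈ B, ∀ I, ContDiffAt ℝ 2 (fun y => V y I) x)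
    (hK : ∀ x ∈ B, ∀ I J, pd J (fun y => V y I) x + pd I (fun y => V y J) x = 0)
    {x : Fin n → ℝ} (hx : x ∈ B) (I J K : Fin n) :
    pd K (pd J fun y => V y I) x = 0 := by
  have skew (I J K : Fin n) :
      pd K (pd J fun y => V y I) x = -pd K (pd I fun y => V y J) x := by
    have he : (pd J fun y => V y I) =ᶠ[nhds x] fun z => -(pd I fun y => V y J) z := by
      filter_upwards [hB.mem_nhds hx] with z hz
      exact eq_neg_of_add_eq_zero_left (hK z hz I J)
    rw [pd, he.fderiv_eq, fderiv_fun_neg]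
    rfl
  have symm (I J K : Fin n) := pd_comm (hV x hx I) J K
  linarith [skew I J K, symm J I K, skew J K I, symm K J I, skew K I J, symm I K J]

/-- On a connected open set, a Killing field is affine with skew-symmetric linear part. -/
theorem exists_eqOn_affineKillingField {n : ℕ} {B : Set (Fin n → ℝ)} (hB : IsOpen B)
    (hBconn : IsConnected B) {V : (Fin n → ℝ) → Fin n → ℝ}
    (hV : ∀ x ∈ B, ∀ I, ContDiffAt ℝ 2 (fun y => V y I) x)
    (hK : ∀ x ∈ B, ∀ I J, pd J (fun y => V y I) x + pd I (fun y => V y J) x = 0) :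
    ∃ c, Set.EqOn V (affineKillingField n c) B := by
  obtain ⟨x₀, hx₀⟩ := hBconn.nonempty
  let A (I J : Fin n) : ℝ := pd J (fun y => V y I) x₀
  let c : KillingIndex n → ℝ :=
    Sum.elim (fun I => V x₀ I - ∑ J, A I J * x₀ J) fun p => A p.1.1 p.1.2
  have hc := skewOfUpper_eq_of_skew (c := c) (A := A) (hK x₀ hx₀) fun _ => rfl
  have hconst (I J : Fin n) : Set.EqOn (pd J fun y => V y I) (fun _ => A I J) B := by
    refine hB.eqOn_of_fderiv_eq (𝕜 := ℝ) hBconn.isPreconnected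
      (fun x hx => (differentiableAt_pd (hV x hx I) J).differentiableWithinAt)
      (differentiableOn_const _) (fun x hx => fderiv_eq_of_pd_eq fun K => ?_) hx₀ rfl
    rw [pd_pd_eq_zero_of_killing hB hV hK hx]
    simp [pd]
  refine ⟨c, fun x hx => funext fun I => ?_⟩
  have hcd : ContDiff ℝ 1 fun y => affineKillingField n c y I :=
    contDiff_pi.mp (contDiff_affineKillingField c) I
  refine hB.eqOn_of_fderiv_eq (𝕜 := ℝ) (f := fun y => V y I)
    (g := fun y => affineKillingField n c y I) hBconn.isPreconnected
    (fun x hx => ((hV x hx I).differentiableAt (by norm_num)).differentiableWithinAt)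
    (hcd.differentiable (by norm_num)).differentiableOn
    (fun x hx => fderiv_eq_of_pd_eq fun J => ?_) hx₀ ?_ hx
  · rw [hconst I J hx, pd_affineKillingField, hc]
  · simp [affineKillingField_apply, hc, c]

theorem eq_of_eqOn_affineKillingField {n : ℕ} {B : Set (Fin n → ℝ)} (hB : IsOpen B)
    (hne : B.Nonempty) {c d : KillingIndex n → ℝ}
    (h : Set.EqOn (affineKillingField n c) (affineKillingField n d) B) : c = d := by
  obtain ⟨x, hx⟩ := hne
  have hskew (I J : Fin n) : skewOfUpper c I J = skewOfUpper d I J := by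
    rw [← pd_affineKillingField c I J x, ← pd_affineKillingField d I J x, pd, pd]
    congr 1
    refine Filter.EventuallyEq.fderiv_eq ?_
    filter_upwards [hB.mem_nhds hx] with y hy
    rw [h hy]
  ext (I | ⟨⟨I, J⟩, hIJ⟩)
  · have := congrFun (h hx) I
    simpa [affineKillingField_apply, hskew] using this
  · simpa [skewOfUpper, show I < J from hIJ] using hskew I J

theorem affineKillingField_eq_sum {n : ℕ} {ι : Type*} [Fintype ι] (e : ι ≃ KillingIndex n)
    (c : KillingIndex n → ℝ) (x : Fin n → ℝ) :
    affineKillingField n c x =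
      ∑ k, c (e k) • affineKillingField n (Pi.single (e k) 1) x := by
  rw [e.sum_comp fun k => c k • affineKillingField n (Pi.single k 1) x]
  conv_lhs => rw [pi_eq_sum_univ' c, map_sum, Finset.sum_apply]
  refine Finset.sum_congr rfl fun k _ => ?_
  rw [map_smul, Pi.smul_apply]

/-- The space of Killing vector fields on a nonempty open connected `B ⊆ ℝⁿ` has
dimension `n(n+1)/2`: there are `n(n+1)/2` Killing fields on `B` such that every Killing
field on `B` is, on `B`, a unique linear combination of them. -/
theorem killing_fields_dimension
    (n : ℕ) (B : Set (Fin n → ℝ)) (hB : IsOpen B) (hBconn : IsConnected B) :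
    ∃ U : Fin (n * (n + 1) / 2) → (Fin n → ℝ) → Fin n → ℝ,
      (∀ k, ContDiffOn ℝ (⊤ : ℕ∞) (U k) B ∧
        ∀ x ∈ B, ∀ I J,
          pd J (fun y => U k y I) x + pd I (fun y => U k y J) x = 0) ∧
      ∀ V : (Fin n → ℝ) → Fin n → ℝ, ContDiffOn ℝ (⊤ : ℕ∞) V B →
        (∀ x ∈ B, ∀ I J,
          pd J (fun y => V y I) x + pd I (fun y => V y J) x = 0) →
        ∃! c : Fin (n * (n + 1) / 2) → ℝ,
          ∀ x ∈ B, V x = ∑ k, c k • U k x := by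
  let e : Fin (n * (n + 1) / 2) ≃ KillingIndex n :=
    (Fintype.equivFinOfCardEq (card_killingIndex n)).symm
  refine ⟨fun k => affineKillingField n (Pi.single (e k) 1), fun k =>
    ⟨(contDiff_affineKillingField _).contDiffOn, fun x _ I J => ?_⟩, fun V hV hK => ?_⟩
  · rw [pd_affineKillingField, pd_affineKillingField, skewOfUpper_add_swap]
  have hV' : ∀ x ∈ B, ∀ I, ContDiffAt ℝ 2 (fun y => V y I) x := fun x hx I =>
    contDiffAt_pi.mp ((hV.contDiffAt (hB.mem_nhds hx)).of_le
      (WithTop.coe_le_coe.mpr (le_top : (2 : ℕ∞) ≤ ⊤))) I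
  obtain ⟨c, hc⟩ := exists_eqOn_affineKillingField hB hBconn hV' hK
  refine ⟨c ∘ e, fun x hx => (hc hx).trans (affineKillingField_eq_sum e c x), fun d hd => ?_⟩
  have hdc : d ∘ e.symm = c := by
    refine eq_of_eqOn_affineKillingField hB hBconn.nonempty fun x hx => ?_
    rw [← hc hx, hd x hx, affineKillingField_eq_sum e]
    simp
  ext k
  simp [← hdc]
end

section
/- Let B ⊆ ℝ² be open and let T be a smooth symmetric (²₀)-tensor field on B (T^{IJ} = T^{JI}). Then there exists a smooth function f : B → ℝ (an Airy stress function) with T = D_s f, i.e. T^{11} = ∂_2∂_2 f, T^{12} = −∂_1∂_2 f, and T^{22} = ∂_1∂_1 f on B, if and only if all of the following hold: (i) div T = 0 on B, i.e. ∂_1 T^{I1} + ∂_2 T^{I2} = 0 on B for I = 1, 2; (ii) for every smooth closed curve γ in B and every I ∈ {1,2}, ∫₀¹ [T^{I2}(γ(t)) γ′¹(t) − T^{I1}(γ(t)) γ′²(t)] dt = 0; and (iii) for every smooth closed curve γ in B, ∫₀¹ [ (γ¹(t) T^{22}(γ(t)) − γ²(t) T^{12}(γ(t))) γ′¹(t)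 − (γ¹(t) T^{21}(γ(t)) − γ²(t) T^{11}(γ(t))) γ′²(t) ] dt = 0. -/
/-- A smooth closed curve lying in `B`. -/
def IsSmoothClosedCurveIn {n : ℕ} (B : Set (Fin n → ℝ)) (γ : ℝ → Fin n → ℝ) : Prop :=
  ContDiff ℝ (⊤ : ℕ∞) γ ∧ (∀ t, γ (t + 1) = γ t) ∧ ∀ t, γ t ∈ B

namespace Airy

open MeasureTheory Set Filter Topology


section Potential

variable {E : Type*} [NormedAddCommGroup E] [NormedSpace ℝ E]

/-- A smooth path in `B` from `a` to `b` that is constant outside `[1/3, 2/3]`. -/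
structure IsFlatPath (B : Set E) (a b : E) (γ : ℝ → E) : Prop where
  contDiff : ContDiff ℝ (⊤ : ℕ∞) γ
  left : ∀ t ≤ 1 / 3, γ t = a
  right : ∀ t ≥ 2 / 3, γ t = b
  mem : ∀ t, γ t ∈ B

/-- The pullback of the `1`-form `α` along `γ`. -/
noncomputable def pullback (α : E → E →L[ℝ] ℝ) (γ : ℝ → E) (t : ℝ) : ℝ := α (γ t) (deriv γ t)

variable {B : Set E} {a b c : E} {γ γ₁ γ₂ : ℝ → E} {α : E → E →L[ℝ] ℝ}

lemma continuous_pullback (hα : ContinuousOn α B) (hγ : ContDiff ℝ (⊤ : ℕ∞) γ) (hB : ∀ t, γ t ∈ B) :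
    Continuous (pullback α γ) :=
  (hα.comp_continuous hγ.continuous hB).clm_apply (hγ.continuous_deriv (by simp))

namespace IsFlatPath

lemma deriv_of_lt (h : IsFlatPath B a b γ) {t : ℝ} (ht : t < 1 / 3) : deriv γ t = 0 := by
  have : γ =ᶠ[𝓝 t] fun _ ↦ a := by
    filter_upwards [Iio_mem_nhds ht] with s hs using h.left s (le_of_lt hs)
  rw [this.deriv_eq, deriv_const]

lemma deriv_of_gt (h : IsFlatPath B a b γ) {t : ℝ} (ht : 2 / 3 < t) : deriv γ t = 0 := by
  have : γ =ᶠ[𝓝 t] fun _ ↦ b := by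
    filter_upwards [Ioi_mem_nhds ht] with s hs using h.right s (le_of_lt hs)
  rw [this.deriv_eq, deriv_const]

lemma pullback_eq_zero (h : IsFlatPath B a b γ) (α : E → E →L[ℝ] ℝ) {t : ℝ}
    (ht : t ∉ Icc (1 / 3 : ℝ) (2 / 3)) : pullback α γ t = 0 := by
  rw [mem_Icc, not_and_or, not_le, not_le] at ht
  rcases ht with ht | ht
  · simp [pullback, h.deriv_of_lt ht]
  · simp [pullback, h.deriv_of_gt ht]

lemma integrable (h : IsFlatPath B a b γ) (hα : ContinuousOn α B) :
    Integrable (pullback α γ) :=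
  (continuous_pullback hα h.contDiff h.mem).integrable_of_hasCompactSupport
    (HasCompactSupport.intro isCompact_Icc fun _ ↦ h.pullback_eq_zero α)

lemma integral_eq (h : IsFlatPath B a b γ) (α : E → E →L[ℝ] ℝ) :
    ∫ t in (0 : ℝ)..1, pullback α γ t = ∫ t, pullback α γ t := by
  refine intervalIntegral.integral_eq_integral_of_support_subset fun t ht ↦ ?_
  by_contra hc
  refine ht (h.pullback_eq_zero α fun h' ↦ hc ⟨?_, ?_⟩) <;> linarith [h'.1, h'.2]

lemma const (ha : a ∈ B) : IsFlatPath B a a fun _ ↦ a :=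
  ⟨contDiff_const, fun _ _ ↦ rfl, fun _ _ ↦ rfl, fun _ ↦ ha⟩

lemma reverse (h : IsFlatPath B a b γ) : IsFlatPath B b a fun t ↦ γ (1 - t) where
  contDiff := h.contDiff.comp (by fun_prop)
  left t ht := h.right _ (by linarith)
  right t ht := h.left _ (by linarith)
  mem t := h.mem _

lemma integral_reverse (γ : ℝ → E) (α : E → E →L[ℝ] ℝ) :
    ∫ t, pullback α (fun t ↦ γ (1 - t)) t = -∫ t, pullback α γ t := by
  have : pullback α (fun t ↦ γ (1 - t)) = fun t ↦ -pullback α γ (1 - t) := by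
    ext t
    simp [pullback, deriv_comp_const_sub]
  rw [this, integral_neg, integral_sub_left_eq_self (pullback α γ)]

lemma concat (h₁ : IsFlatPath B a b γ₁) (h₂ : IsFlatPath B b c γ₂) :
    IsFlatPath B a c fun t ↦ γ₁ (2 * t - 1 / 3) + γ₂ (2 * t - 2 / 3) - b where
  contDiff := ((h₁.contDiff.comp (by fun_prop)).add (h₂.contDiff.comp (by fun_prop))).sub
    contDiff_const
  left t ht := by
    rw [h₁.left _ (by linarith), h₂.left _ (by linarith)]
    abel
  right t ht := by
    rw [h₁.right _ (by linarith), h₂.right _ (by linarith)]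
    abel
  mem t := by
    rcases le_total t (1 / 2) with ht | ht
    · rw [h₂.left _ (by linarith), add_sub_cancel_right]
      exact h₁.mem _
    · rw [h₁.right _ (by linarith), add_sub_cancel_left]
      exact h₂.mem _

lemma integral_concat (h₁ : IsFlatPath B a b γ₁) (h₂ : IsFlatPath B b c γ₂)
    (hα : ContinuousOn α B) :
    ∫ t, pullback α (fun t ↦ γ₁ (2 * t - 1 / 3) + γ₂ (2 * t - 2 / 3) - b) t =
      (∫ t, pullback α γ₁ t) + ∫ t, pullback α γ₂ t := by
  have hderiv : ∀ t, deriv (fun t ↦ γ₁ (2 * t - 1 / 3) + γ₂ (2 * t - 2 / 3) - b) t =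
      (2 : ℝ) • deriv γ₁ (2 * t - 1 / 3) + (2 : ℝ) • deriv γ₂ (2 * t - 2 / 3) := by
    intro t
    have hlin : ∀ r : ℝ, HasDerivAt (fun t : ℝ ↦ 2 * t - r) 2 t := fun r ↦ by
      simpa using ((hasDerivAt_id t).const_mul (2 : ℝ)).sub_const r
    exact ((((h₁.contDiff.differentiable (by simp) _).hasDerivAt.scomp t (hlin _)).add
      ((h₂.contDiff.differentiable (by simp) _).hasDerivAt.scomp t (hlin _))).sub_const b).deriv
  have key : pullback α (fun t ↦ γ₁ (2 * t - 1 / 3) + γ₂ (2 * t - 2 / 3) - b) = fun t ↦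
      2 * pullback α γ₁ (2 * t - 1 / 3) + 2 * pullback α γ₂ (2 * t - 2 / 3) := by
    ext t
    simp only [pullback, hderiv, map_add, map_smul, smul_eq_mul]
    rcases lt_trichotomy t (1 / 2) with ht | ht | ht
    · rw [h₂.deriv_of_lt (by linarith), h₂.left _ (by linarith), add_sub_cancel_right]
      simp
    · rw [h₁.right (2 * t - 1 / 3) (by linarith), h₂.left _ (by linarith), add_sub_cancel_right]
    · rw [h₁.deriv_of_gt (by linarith), h₁.right _ (by linarith), add_sub_cancel_left]
      simp
  have hint : ∀ {f : ℝ → ℝ} (r : ℝ), Integrable f →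
      Integrable (fun t ↦ 2 * f (2 * t - r)) ∧ ∫ t, 2 * f (2 * t - r) = ∫ t, f t := by
    intro f r hf
    refine ⟨((hf.comp_sub_right r).comp_mul_left' two_ne_zero).const_mul 2, ?_⟩
    rw [integral_const_mul, Measure.integral_comp_mul_left (fun t ↦ f (t - r)),
      integral_sub_right_eq_self]
    norm_num
    ring
  obtain ⟨hi₁, he₁⟩ := hint (1 / 3) (h₁.integrable hα)
  obtain ⟨hi₂, he₂⟩ := hint (2 / 3) (h₂.integrable hα)
  rw [key, integral_add hi₁ hi₂, he₁, he₂]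

/-- Periodising a flat loop gives a smooth curve. -/
lemma contDiff_comp_fract (h : IsFlatPath B a a γ) : ContDiff ℝ (⊤ : ℕ∞) fun t ↦ γ (Int.fract t) := by
  refine contDiff_iff_contDiffAt.2 fun t ↦ ?_
  rcases (Int.floor_le t).eq_or_lt with ht | ht
  · refine (contDiffAt_const (c := a)).congr_of_eventuallyEq ?_
    filter_upwards [Ioo_mem_nhds (show t - 1 / 3 < t by linarith)
      (show t < t + 1 / 3 by linarith)] with s hs
    rcases le_or_gt t s with hts | hts
    · refine h.left _ ?_
      rw [(Int.fract_eq_iff (b := s - ⌊t⌋)).2 ⟨by linarith, by linarith [hs.2], ⌊t⌋, by simp⟩]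
      linarith [hs.2]
    · refine h.right _ ?_
      rw [(Int.fract_eq_iff (b := s - (⌊t⌋ - 1 : ℤ))).2
        ⟨by push_cast; linarith [hs.1], by push_cast; linarith, ⌊t⌋ - 1, by simp⟩]
      push_cast
      linarith [hs.1]
  · have : ContDiffAt ℝ (⊤ : ℕ∞) (fun s : ℝ ↦ γ (s - ⌊t⌋)) t :=
      (h.contDiff.comp (by fun_prop)).contDiffAt
    refine this.congr_of_eventuallyEq ?_
    filter_upwards [Ioo_mem_nhds ht (Int.lt_floor_add_one t)] with s hs
    rw [(Int.fract_eq_iff (b := s - ⌊t⌋)).2 ⟨by linarith [hs.1], by linarith [hs.2], ⌊t⌋, by simp⟩]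

lemma integral_loop_eq_zero (h : IsFlatPath B a a γ)
    (hloop : ∀ γ : ℝ → E, ContDiff ℝ (⊤ : ℕ∞) γ → (∀ t, γ (t + 1) = γ t) → (∀ t, γ t ∈ B) →
      ∫ t in (0 : ℝ)..1, pullback α γ t = 0) :
    ∫ t, pullback α γ t = 0 := by
  rw [← h.integral_eq]
  refine Eq.trans ?_ (hloop _ h.contDiff_comp_fract (by simp) fun t ↦ h.mem _)
  rw [intervalIntegral.integral_of_le zero_le_one, intervalIntegral.integral_of_le zero_le_one,
    integral_Ioc_eq_integral_Ioo, integral_Ioc_eq_integral_Ioo]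
  refine setIntegral_congr_fun measurableSet_Ioo fun t ht ↦ ?_
  have heq : (fun t ↦ γ (Int.fract t)) =ᶠ[𝓝 t] γ := by
    filter_upwards [Ioo_mem_nhds ht.1 ht.2] with s hs
    rw [Int.fract_eq_self.2 ⟨hs.1.le, hs.2⟩]
  simp only [pullback]
  rw [heq.deriv_eq, Int.fract_eq_self.2 ⟨ht.1.le, ht.2⟩]

/-- A segment contained in `B` can be traversed by a flat path. -/
lemma exists_of_segment_subset (hα : ContinuousOn α B) (hs : segment ℝ a b ⊆ B) :
    ∃ γ, IsFlatPath B a b γ ∧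
      ∫ t, pullback α γ t = ∫ t in (0 : ℝ)..1, α (AffineMap.lineMap a b t) (b - a) := by
  set η : ℝ → ℝ := fun t ↦ Real.smoothTransition (3 * t - 1) with hη
  have hηc : ContDiff ℝ (⊤ : ℕ∞) η := Real.smoothTransition.contDiff.comp (by fun_prop)
  have hmem : ∀ s ∈ Icc (0 : ℝ) 1, AffineMap.lineMap a b s ∈ B := fun s hs' ↦
    hs (segment_eq_image_lineMap ℝ a b ▸ mem_image_of_mem _ hs')
  have hγ : IsFlatPath B a b fun t ↦ AffineMap.lineMap a b (η t) := by
    refine ⟨?_, fun t ht ↦ ?_, fun t ht ↦ ?_, fun t ↦ hmem _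
      ⟨Real.smoothTransition.nonneg _, Real.smoothTransition.le_one _⟩⟩
    · simp only [AffineMap.lineMap_apply_module']
      fun_prop
    · simp [hη, Real.smoothTransition.zero_of_nonpos (show 3 * t - 1 ≤ 0 by linarith)]
    · simp [hη, Real.smoothTransition.one_of_one_le (show 1 ≤ 3 * t - 1 by linarith)]
  refine ⟨_, hγ, ?_⟩
  have hη' : ∀ t, HasDerivAt η (deriv η t) t := fun t ↦
    (hηc.differentiable (by simp) t).hasDerivAt
  have hsub := intervalIntegral.integral_comp_mul_deriv' (a := 0) (b := 1) (f := η)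
    (f' := deriv η) (g := fun s ↦ α (AffineMap.lineMap a b s) (b - a)) (fun t _ ↦ hη' t)
    (hηc.continuous_deriv (by simp)).continuousOn (by
      refine ContinuousOn.clm_apply (hα.comp (by fun_prop) ?_) continuousOn_const
      rintro _ ⟨t, -, rfl⟩
      exact hmem _ ⟨Real.smoothTransition.nonneg _, Real.smoothTransition.le_one _⟩)
  have h0 : η 0 = 0 := Real.smoothTransition.zero_of_nonpos (by norm_num)
  have h1 : η 1 = 1 := Real.smoothTransition.one_of_one_le (by norm_num)
  rw [h0, h1] at hsub
  rw [← hsub, ← hγ.integral_eq]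
  refine intervalIntegral.integral_congr fun t _ ↦ ?_
  have hd : HasDerivAt (fun t ↦ AffineMap.lineMap a b (η t)) (deriv η t • (b - a)) t := by
    simp only [AffineMap.lineMap_apply_module']
    exact ((hη' t).smul_const (b - a)).add_const a
  simp only [pullback, Function.comp]
  rw [hd.deriv, map_smul, smul_eq_mul, mul_comm]

end IsFlatPath

/-- A continuous `1`-form on an open set whose integral over every smooth closed curve vanishes
is exact. -/
lemma exists_potential (hB : IsOpen B) (hα : ContinuousOn α B)
    (hloop : ∀ γ : ℝ → E, ContDiff ℝ (⊤ : ℕ∞) γ → (∀ t, γ (t + 1) = γ t) → (∀ t, γ t ∈ B) →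
      ∫ t in (0 : ℝ)..1, pullback α γ t = 0) :
    ∃ g : E → ℝ, ∀ x ∈ B, HasFDerivAt g (α x) x := by
  classical
  set r : E → E → Prop := fun a b ↦ ∃ γ, IsFlatPath B a b γ
  have htrans : ∀ {a b c}, r a b → r b c → r a c := fun ⟨_, h₁⟩ ⟨_, h₂⟩ ↦ ⟨_, h₁.concat h₂⟩
  have hsymm : ∀ {a b}, r a b → r b a := fun ⟨_, h⟩ ↦ ⟨_, h.reverse⟩
  have hindep : ∀ {a b : E} {γ₁ γ₂ : ℝ → E}, IsFlatPath B a b γ₁ → IsFlatPath B a b γ₂ →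
      ∫ t, pullback α γ₁ t = ∫ t, pullback α γ₂ t := by
    intro a b γ₁ γ₂ h₁ h₂
    have h := (h₁.concat h₂.reverse).integral_loop_eq_zero hloop
    rw [h₁.integral_concat h₂.reverse hα, IsFlatPath.integral_reverse] at h
    linarith
  set base : E → E := fun x ↦ @Classical.epsilon E ⟨x⟩ fun z ↦ r z x
  have hbase : ∀ x ∈ B, r (base x) x := fun x hx ↦
    Classical.epsilon_spec (p := fun z ↦ r z x) ⟨x, _, IsFlatPath.const hx⟩
  have hbase_eq : ∀ {x y}, r x y → base x = base y := by
    intro x y hxy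
    have : (fun z ↦ r z x) = fun z ↦ r z y :=
      funext fun z ↦ propext ⟨fun h ↦ htrans h hxy, fun h ↦ htrans h (hsymm hxy)⟩
    simp only [base, this]
  choose! path hpath using hbase
  refine ⟨fun x ↦ ∫ t, pullback α (path x) t, fun x hx ↦ ?_⟩
  have hseg : HasFDerivAt (curveIntegral α <| Path.segment x ·) (α x) x :=
    .curveIntegral_segment_source' <| by
      filter_upwards [hB.mem_nhds hx] with z hz using hα.continuousAt (hB.mem_nhds hz)
  refine (hseg.const_add (∫ t, pullback α (path x) t)).congr_of_eventuallyEq ?_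
  obtain ⟨ε, hε, hball⟩ := Metric.isOpen_iff.1 hB x hx
  filter_upwards [Metric.ball_mem_nhds x hε] with y hy
  obtain ⟨s, hs, hhseg_int⟩ := IsFlatPath.exists_of_segment_subset hα
    (((convex_ball x ε).segment_subset (Metric.mem_ball_self hε) hy).trans hball)
  rw [curveIntegral_segment, ← hhseg_int, ← (hpath x hx).integral_concat hs hα]
  refine hindep (hpath y (hball hy)) ?_
  rw [← hbase_eq ⟨s, hs⟩]
  exact (hpath x hx).concat hs

/-- The integral of an exact `1`-form over a closed curve vanishes. -/
lemma integral_fderiv_closed_curve {g : E → ℝ} (hB : IsOpen B) (hg : ContDiffOn ℝ (⊤ : ℕ∞) g B)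
    (hγ : ContDiff ℝ (⊤ : ℕ∞) γ) (hper : ∀ t, γ (t + 1) = γ t) (hmem : ∀ t, γ t ∈ B) :
    ∫ t in (0 : ℝ)..1, pullback (fderiv ℝ g) γ t = 0 := by
  have hd : ∀ t, HasDerivAt (g ∘ γ) (pullback (fderiv ℝ g) γ t) t := fun t ↦
    ((hg.differentiableOn (by simp)).differentiableAt
      (hB.mem_nhds (hmem t))).hasFDerivAt.comp_hasDerivAt t
      (hγ.differentiable (by simp) t).hasDerivAt
  rw [intervalIntegral.integral_eq_sub_of_hasDerivAt (fun t _ ↦ hd t)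
    ((continuous_pullback (hg.continuousOn_fderiv_of_isOpen hB (by simp)) hγ
      hmem).intervalIntegrable _ _)]
  have := hper 0
  simp_all

end Potential

section Plane

variable {B : Set (Fin 2 → ℝ)} {f g u v P Q : (Fin 2 → ℝ) → ℝ} {x : Fin 2 → ℝ}

lemma apply_eq_sum (L : (Fin 2 → ℝ) →L[ℝ] ℝ) (v : Fin 2 → ℝ) :
    L v = L (Pi.single 0 1) * v 0 + L (Pi.single 1 1) * v 1 := by
  have hv : v = v 0 • Pi.single 0 1 + v 1 • Pi.single 1 1 := by
    ext i
    fin_cases i <;> simp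
  conv_lhs => rw [hv]
  simp only [map_add, map_smul, smul_eq_mul]
  ring

lemma contDiffOn_pd (hB : IsOpen B) (hf : ContDiffOn ℝ (⊤ : ℕ∞) f B) (K : Fin 2) :
    ContDiffOn ℝ (⊤ : ℕ∞) (pd K f) B :=
  (((contDiffOn_infty_iff_fderiv_of_isOpen hB).1 hf).2).clm_apply contDiffOn_const

lemma pd_congr (hB : IsOpen B) (h : EqOn u v B) (hx : x ∈ B) (K : Fin 2) :
    pd K u x = pd K v x := by
  simp only [pd, (h.eventuallyEq_of_mem (hB.mem_nhds hx)).fderiv_eq]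

lemma pd_comm (hB : IsOpen B) (hf : ContDiffOn ℝ (⊤ : ℕ∞) f B) (hx : x ∈ B) (K L : Fin 2) :
    pd K (pd L f) x = pd L (pd K f) x := by
  have hd : DifferentiableAt ℝ (fderiv ℝ f) x :=
    (((contDiffOn_infty_iff_fderiv_of_isOpen hB).1 hf).2.differentiableOn (by simp)).differentiableAt
      (hB.mem_nhds hx)
  have key : ∀ I J : Fin 2,
      pd I (pd J f) x = fderiv ℝ (fderiv ℝ f) x (Pi.single I 1) (Pi.single J 1) := by
    intro I J
    have := (hd.hasFDerivAt.clm_apply (hasFDerivAt_const (Pi.single J (1 : ℝ)) x)).fderiv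
    change fderiv ℝ (fun y ↦ fderiv ℝ f y (Pi.single J 1)) x _ = _
    rw [this]
    simp
  rw [key, key]
  exact ((hf.contDiffAt (hB.mem_nhds hx)).isSymmSndFDerivAt (by
    rw [minSmoothness_of_isRCLikeNormedField]
    exact WithTop.coe_le_coe.2 (le_top : (2 : ℕ∞) ≤ ⊤))).eq _ _

lemma pd_neg (K : Fin 2) (f : (Fin 2 → ℝ) → ℝ) (x : Fin 2 → ℝ) :
    pd K (fun y ↦ -f y) x = -pd K f x := by
  simp [pd, fderiv_fun_neg]

lemma integral_pd_closed_curve (hB : IsOpen B) (hg : ContDiffOn ℝ (⊤ : ℕ∞) g B)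
    {γ : ℝ → Fin 2 → ℝ} (hγ : IsSmoothClosedCurveIn B γ) :
    ∫ t in (0 : ℝ)..1, (pd 0 g (γ t) * deriv γ t 0 + pd 1 g (γ t) * deriv γ t 1) = 0 := by
  refine Eq.trans ?_ (integral_fderiv_closed_curve hB hg hγ.1 hγ.2.1 hγ.2.2)
  exact intervalIntegral.integral_congr fun t _ ↦ (apply_eq_sum _ _).symm

lemma exists_potential_of_closed_curves (hB : IsOpen B) (hP : ContDiffOn ℝ (⊤ : ℕ∞) P B)
    (hQ : ContDiffOn ℝ (⊤ : ℕ∞) Q B)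
    (h : ∀ γ : ℝ → Fin 2 → ℝ, IsSmoothClosedCurveIn B γ →
      ∫ t in (0 : ℝ)..1, (P (γ t) * deriv γ t 0 + Q (γ t) * deriv γ t 1) = 0) :
    ∃ g : (Fin 2 → ℝ) → ℝ, ContDiffOn ℝ (⊤ : ℕ∞) g B ∧
      EqOn (pd 0 g) P B ∧ EqOn (pd 1 g) Q B := by
  set α : (Fin 2 → ℝ) → (Fin 2 → ℝ) →L[ℝ] ℝ := fun x ↦
    P x • ContinuousLinearMap.proj 0 + Q x • ContinuousLinearMap.proj 1 with hα_def
  have hα : ContDiffOn ℝ (⊤ : ℕ∞) α B :=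
    (hP.smul contDiffOn_const).add (hQ.smul contDiffOn_const)
  obtain ⟨g, hg⟩ := exists_potential hB hα.continuousOn fun γ hγ hper hmem ↦ by
    simpa [pullback, hα_def] using h γ ⟨hγ, hper, hmem⟩
  refine ⟨g, (contDiffOn_infty_iff_fderiv_of_isOpen hB).2
    ⟨fun x hx ↦ (hg x hx).differentiableAt.differentiableWithinAt,
      hα.congr fun x hx ↦ (hg x hx).fderiv⟩, fun x hx ↦ ?_, fun x hx ↦ ?_⟩ <;>
  simp [pd, (hg x hx).fderiv, hα_def]

lemma pd_coord_mul_sub (hu : DifferentiableAt ℝ u x) (hv : DifferentiableAt ℝ v x)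
    (hg : DifferentiableAt ℝ g x) (K : Fin 2) :
    pd K (fun y ↦ y 0 * u y + y 1 * v y - g y) x =
      x 0 * pd K u x + (Pi.single K 1 : Fin 2 → ℝ) 0 * u x +
        (x 1 * pd K v x + (Pi.single K 1 : Fin 2 → ℝ) 1 * v x) - pd K g x := by
  have hc : ∀ i : Fin 2, HasFDerivAt (fun y : Fin 2 → ℝ ↦ y i)
      (ContinuousLinearMap.proj (R := ℝ) (φ := fun _ : Fin 2 ↦ ℝ) i) x :=
    fun i ↦ hasFDerivAt_apply i x
  have hd := (((hc 0).fun_mul hu.hasFDerivAt).fun_add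
    ((hc 1).fun_mul hv.hasFDerivAt)).fun_sub hg.hasFDerivAt
  rw [pd, hd.fderiv]
  simp only [pd, _root_.sub_apply, _root_.add_apply,
    _root_.smul_apply, ContinuousLinearMap.proj_apply, smul_eq_mul]
  ring

end Plane

end Airy

/-- A smooth symmetric (²₀)-tensor field `T` on an open set `B ⊆ ℝ²` admits an Airy
stress function (`T^{11} = ∂₂∂₂ f`, `T^{12} = T^{21} = −∂₁∂₂ f`, `T^{22} = ∂₁∂₁ f`) iff
`div T = 0` and the resultant force and moment integrals over all smooth closed curves in
`B` vanish.  (Indices `1,2` are `0,1 : Fin 2`.) -/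
theorem airy_stress_function_iff_2d
    (B : Set (Fin 2 → ℝ)) (hB : IsOpen B)
    (T : (Fin 2 → ℝ) → Fin 2 → Fin 2 → ℝ)
    (hT : ContDiffOn ℝ (⊤ : ℕ∞) T B)
    (hsym : ∀ x ∈ B, ∀ I J, T x I J = T x J I) :
    (∃ f : (Fin 2 → ℝ) → ℝ,
        ContDiffOn ℝ (⊤ : ℕ∞) f B ∧
        ∀ x ∈ B,
          T x 0 0 = pd 1 (fun y => pd 1 f y) x ∧
          T x 0 1 = -pd 0 (fun y => pd 1 f y) x ∧
          T x 1 0 = -pd 0 (fun y => pd 1 f y) x ∧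
          T x 1 1 = pd 0 (fun y => pd 0 f y) x) ↔
      ((∀ x ∈ B, ∀ I, pd 0 (fun y => T y I 0) x + pd 1 (fun y => T y I 1) x = 0) ∧
        (∀ γ : ℝ → Fin 2 → ℝ, IsSmoothClosedCurveIn B γ →
          ∀ I, (∫ t in (0:ℝ)..1,
            T (γ t) I 1 * deriv γ t 0 - T (γ t) I 0 * deriv γ t 1) = 0) ∧
        (∀ γ : ℝ → Fin 2 → ℝ, IsSmoothClosedCurveIn B γ →
          (∫ t in (0:ℝ)..1,
            (γ t 0 * T (γ t) 1 1 - γ t 1 * T (γ t) 0 1) * deriv γ t 0 -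
              (γ t 0 * T (γ t) 1 0 - γ t 1 * T (γ t) 0 0) * deriv γ t 1) = 0)) := by
  have hTc : ∀ I J, ContDiffOn ℝ (⊤ : ℕ∞) (fun y ↦ T y I J) B := fun I J ↦
    contDiffOn_pi.1 (contDiffOn_pi.1 hT I) J
  have hX : ∀ i : Fin 2, ContDiffOn ℝ (⊤ : ℕ∞) (fun y : Fin 2 → ℝ ↦ y i) B := fun i ↦
    (contDiff_apply ℝ ℝ i).contDiffOn
  constructor
  · rintro ⟨f, hf, hTf⟩
    have hf0 := Airy.contDiffOn_pd hB hf 0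
    have hf1 := Airy.contDiffOn_pd hB hf 1
    have h00 : Set.EqOn (fun y ↦ T y 0 0) (pd 1 (pd 1 f)) B := fun x hx ↦ (hTf x hx).1
    have h01 : Set.EqOn (fun y ↦ T y 0 1) (fun y ↦ -pd 0 (pd 1 f) y) B :=
      fun x hx ↦ (hTf x hx).2.1
    have h10 : Set.EqOn (fun y ↦ T y 1 0) (fun y ↦ -pd 1 (pd 0 f) y) B := fun x hx ↦
      (hTf x hx).2.2.1.trans (congrArg Neg.neg (Airy.pd_comm hB hf hx 0 1))
    have h11 : Set.EqOn (fun y ↦ T y 1 1) (pd 0 (pd 0 f)) B := fun x hx ↦ (hTf x hx).2.2.2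
    refine ⟨fun x hx ↦ Fin.forall_fin_two.2 ⟨?_, ?_⟩, fun γ hγ ↦ Fin.forall_fin_two.2 ⟨?_, ?_⟩,
      fun γ hγ ↦ ?_⟩
    · rw [Airy.pd_congr hB h00 hx, Airy.pd_congr hB h01 hx, Airy.pd_neg,
        Airy.pd_comm hB hf1 hx 0 1, add_neg_cancel]
    · rw [Airy.pd_congr hB h10 hx, Airy.pd_congr hB h11 hx, Airy.pd_neg,
        Airy.pd_comm hB hf0 hx 0 1, neg_add_cancel]
    · refine Eq.trans ?_ (neg_eq_zero.2 (Airy.integral_pd_closed_curve hB hf1 hγ))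
      rw [← intervalIntegral.integral_neg]
      refine intervalIntegral.integral_congr fun t _ ↦ ?_
      have e0 := h00 (hγ.2.2 t)
      have e1 := h01 (hγ.2.2 t)
      simp only at e0 e1 ⊢
      rw [e0, e1]
      ring
    · refine Eq.trans ?_ (Airy.integral_pd_closed_curve hB hf0 hγ)
      refine intervalIntegral.integral_congr fun t _ ↦ ?_
      have e0 := h10 (hγ.2.2 t)
      have e1 := h11 (hγ.2.2 t)
      simp only at e0 e1 ⊢
      rw [e0, e1]
      ring
    · refine Eq.trans ?_ (Airy.integral_pd_closed_curve hB
        ((((hX 0).mul hf0).add ((hX 1).mul hf1)).sub hf) hγ)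
      refine intervalIntegral.integral_congr fun t _ ↦ ?_
      have hB' := hB.mem_nhds (hγ.2.2 t)
      have hp := Airy.pd_coord_mul_sub ((hf0.contDiffAt hB').differentiableAt (by simp))
        ((hf1.contDiffAt hB').differentiableAt (by simp))
        ((hf.contDiffAt hB').differentiableAt (by simp))
      have e00 := h00 (hγ.2.2 t)
      have e01 := h01 (hγ.2.2 t)
      have e10 := h10 (hγ.2.2 t)
      have e11 := h11 (hγ.2.2 t)
      simp only at e00 e01 e10 e11 ⊢
      rw [hp, hp, e00, e01, e10, e11]
      simp
      ring
  · rintro ⟨-, hforce, hmoment⟩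
    obtain ⟨p, hp, hp0, hp1⟩ := Airy.exists_potential_of_closed_curves hB (hTc 1 1)
      (hTc 1 0).neg fun γ hγ ↦ by simpa [sub_eq_add_neg] using hforce γ hγ 1
    obtain ⟨q, hq, hq0, hq1⟩ := Airy.exists_potential_of_closed_curves hB (hTc 0 1).neg
      (hTc 0 0) fun γ hγ ↦ by
        have := hforce γ hγ 0
        rw [← neg_eq_zero, ← intervalIntegral.integral_neg] at this
        simpa [sub_eq_add_neg, add_comm] using this
    obtain ⟨h, hh, hh0, hh1⟩ := Airy.exists_potential_of_closed_curves hB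
      (((hX 0).mul (hTc 1 1)).sub ((hX 1).mul (hTc 0 1)))
      (((hX 0).mul (hTc 1 0)).sub ((hX 1).mul (hTc 0 0))).neg
      fun γ hγ ↦ by simpa only [sub_eq_add_neg, neg_mul, Pi.neg_apply] using hmoment γ hγ
    set f : (Fin 2 → ℝ) → ℝ := fun y ↦ y 0 * p y + y 1 * q y - h y
    have hgrad : ∀ x ∈ B, pd 0 f x = p x ∧ pd 1 f x = q x := fun x hx ↦ by
      have hB' := hB.mem_nhds hx
      have hpd := Airy.pd_coord_mul_sub ((hp.contDiffAt hB').differentiableAt (by simp))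
        ((hq.contDiffAt hB').differentiableAt (by simp))
        ((hh.contDiffAt hB').differentiableAt (by simp))
      rw [hpd, hpd, hp0 hx, hp1 hx, hq0 hx, hq1 hx, hh0 hx, hh1 hx]
      constructor <;> simp <;> ring
    have hf0 : Set.EqOn (pd 0 f) p B := fun x hx ↦ (hgrad x hx).1
    have hf1 : Set.EqOn (pd 1 f) q B := fun x hx ↦ (hgrad x hx).2
    refine ⟨f, (((hX 0).mul hp).add ((hX 1).mul hq)).sub hh, fun x hx ↦ ?_⟩
    change _ = pd 1 (pd 1 f) x ∧ _ = -pd 0 (pd 1 f) x ∧ _ = -pd 0 (pd 1 f) x ∧ _ = pd 0 (pd 0 f) x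
    rw [Airy.pd_congr hB hf1 hx, Airy.pd_congr hB hf1 hx, Airy.pd_congr hB hf0 hx,
      hq1 hx, hq0 hx, hp0 hx]
    simp [hsym x hx 1 0]
end

section
/- Let B ⊆ ℝ³ be open and let Y : B → ℝ³ be a smooth vector field. Then there exists a smooth function f : B → ℝ with Y = grad f, i.e. Y^I = ∂_I f on B for I = 1, 2, 3, if and only if both of the following hold: (i) curl Y = 0 on B, i.e. ∂_J Y^K = ∂_K Y^J on B for all J, K; and (ii) for every smooth closed curve γ in B, ∫₀¹ Σ_{I=1}^{3} Y^I(γ(t)) γ′^I(t) dt = 0. -/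
section FlatPath

open Set Filter Topology

variable {E : Type*} [NormedAddCommGroup E] [NormedSpace ℝ E]

/-- The integral of the `1`-form `ω` along the restriction of `γ` to the unit interval. -/
noncomputable def lineIntegral (ω : E → E →L[ℝ] ℝ) (γ : ℝ → E) : ℝ :=
  ∫ t in (0:ℝ)..1, ω (γ t) (deriv γ t)

/-- A smooth path in `B` from `x` to `y` that is constant before time `0` and after time `1`. -/
structure IsFlatPath (B : Set E) (x y : E) (γ : ℝ → E) : Prop where
  smooth : ContDiff ℝ (⊤ : ℕ∞) γ
  eq_source : ∀ t ≤ 0, γ t = x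
  eq_target : ∀ t, 1 ≤ t → γ t = y
  mem : ∀ t, γ t ∈ B

theorem continuous_lineIntegrand {B : Set E} {ω : E → E →L[ℝ] ℝ} {γ : ℝ → E}
    (hω : ContinuousOn ω B) (hγ : ContDiff ℝ (⊤ : ℕ∞) γ) (hB : ∀ t, γ t ∈ B) :
    Continuous fun t ↦ ω (γ t) (deriv γ t) :=
  (hω.comp_continuous hγ.continuous hB).clm_apply (hγ.continuous_deriv (by simp))

theorem lineIntegral_eq_sub {B : Set E} {ω : E → E →L[ℝ] ℝ} {f : E → ℝ} {γ : ℝ → E}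
    (hω : ContinuousOn ω B) (hf : ∀ x ∈ B, HasFDerivAt f (ω x) x)
    (hγ : ContDiff ℝ (⊤ : ℕ∞) γ) (hB : ∀ t, γ t ∈ B) :
    lineIntegral ω γ = f (γ 1) - f (γ 0) :=
  intervalIntegral.integral_eq_sub_of_hasDerivAt (f := f ∘ γ)
    (fun t _ ↦ (hf _ (hB t)).comp_hasDerivAt t (hγ.differentiable (by simp) t).hasDerivAt)
    ((continuous_lineIntegrand hω hγ hB).intervalIntegrable _ _)

/-- Curves agreeing on an open interval have the same line integral over it. -/
theorem integral_deriv_congr {ω : E → E →L[ℝ] ℝ} {γ δ : ℝ → E} {a b : ℝ} (hab : a ≤ b)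
    (h : EqOn γ δ (Ioo a b)) :
    ∫ t in a..b, ω (γ t) (deriv γ t) = ∫ t in a..b, ω (δ t) (deriv δ t) := by
  refine intervalIntegral.integral_congr_Ioo_of_le hab fun t ht ↦ ?_
  have : γ =ᶠ[𝓝 t] δ := h.eventuallyEq_of_mem (isOpen_Ioo.mem_nhds ht)
  simp only [this.deriv_eq, h ht]

/-- Affine reparametrization of a curve does not change its line integral. -/
theorem integral_deriv_comp_mul_sub (ω : E → E →L[ℝ] ℝ) {γ : ℝ → E}
    (hγ : Differentiable ℝ γ) (c d a b : ℝ) :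
    ∫ t in a..b, ω (γ (c * t - d)) (deriv (fun s ↦ γ (c * s - d)) t) =
      ∫ t in (c * a - d)..(c * b - d), ω (γ t) (deriv γ t) := by
  have hd (t : ℝ) : deriv (fun s ↦ γ (c * s - d)) t = c • deriv γ (c * t - d) := by
    have h : HasDerivAt (fun s : ℝ ↦ c * s - d) c t := by
      simpa using ((hasDerivAt_id t).const_mul c).sub_const d
    exact ((hγ _).hasDerivAt.scomp t h).deriv
  simp only [hd, map_smul, smul_eq_mul, intervalIntegral.integral_const_mul]
  exact intervalIntegral.mul_integral_comp_mul_sub (f := fun t ↦ ω (γ t) (deriv γ t)) c d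

namespace IsFlatPath

variable {B : Set E} {x y z : E} {γ δ : ℝ → E}

theorem segment (h : segment ℝ x y ⊆ B) :
    IsFlatPath B x y fun t ↦ AffineMap.lineMap x y (Real.smoothTransition t) where
  smooth := by
    simp only [AffineMap.lineMap_apply_module']
    exact (Real.smoothTransition.contDiff.smul contDiff_const).add contDiff_const
  eq_source t ht := by simp [Real.smoothTransition.zero_of_nonpos ht]
  eq_target t ht := by simp [Real.smoothTransition.one_of_one_le ht]
  mem t := h <| by
    rw [segment_eq_image_lineMap]
    exact mem_image_of_mem _ ⟨Real.smoothTransition.nonneg t, Real.smoothTransition.le_one t⟩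

theorem symm (h : IsFlatPath B x y γ) : IsFlatPath B y x fun t ↦ γ (-1 * t - -1) where
  smooth := h.smooth.comp (by fun_prop)
  eq_source t ht := h.eq_target _ (by linarith)
  eq_target t ht := h.eq_source _ (by linarith)
  mem _ := h.mem _

theorem lineIntegral_symm (h : IsFlatPath B x y γ) (ω : E → E →L[ℝ] ℝ) :
    lineIntegral ω (fun t ↦ γ (-1 * t - -1)) = -lineIntegral ω γ := by
  rw [lineIntegral, integral_deriv_comp_mul_sub ω (h.smooth.differentiable (by simp)),
    intervalIntegral.integral_symm, lineIntegral]
  norm_num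

/-- Concatenation of two paths at double speed. -/
def concat (y : E) (γ δ : ℝ → E) (t : ℝ) : E := γ (2 * t - 0) + (δ (2 * t - 1) - y)

theorem concat_of_le (hδ : IsFlatPath B y z δ) {t : ℝ} (ht : t ≤ 1 / 2) :
    concat y γ δ t = γ (2 * t - 0) := by
  simp [concat, hδ.eq_source (2 * t - 1) (by linarith)]

theorem concat_of_ge (hγ : IsFlatPath B x y γ) {t : ℝ} (ht : 1 / 2 ≤ t) :
    concat y γ δ t = δ (2 * t - 1) := by
  simp [concat, hγ.eq_target (2 * t) (by linarith)]

theorem trans (hγ : IsFlatPath B x y γ) (hδ : IsFlatPath B y z δ) :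
    IsFlatPath B x z (concat y γ δ) where
  smooth := (hγ.smooth.comp (by fun_prop)).add
    ((hδ.smooth.comp (by fun_prop)).sub contDiff_const)
  eq_source t ht := by rw [hδ.concat_of_le (by linarith), hγ.eq_source _ (by linarith)]
  eq_target t ht := by rw [hγ.concat_of_ge (by linarith), hδ.eq_target _ (by linarith)]
  mem t := by
    rcases le_total t (1 / 2) with ht | ht
    · rw [hδ.concat_of_le ht]; exact hγ.mem _
    · rw [hγ.concat_of_ge ht]; exact hδ.mem _

theorem lineIntegral_concat {ω : E → E →L[ℝ] ℝ} (hω : ContinuousOn ω B)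
    (hγ : IsFlatPath B x y γ) (hδ : IsFlatPath B y z δ) :
    lineIntegral ω (concat y γ δ) = lineIntegral ω γ + lineIntegral ω δ := by
  have hc := continuous_lineIntegrand hω (hγ.trans hδ).smooth (hγ.trans hδ).mem
  rw [lineIntegral, ← intervalIntegral.integral_add_adjacent_intervals (b := 1 / 2)
      (hc.intervalIntegrable _ _) (hc.intervalIntegrable _ _),
    integral_deriv_congr (by norm_num) fun t ht ↦ hδ.concat_of_le (γ := γ) ht.2.le,
    integral_deriv_congr (by norm_num) fun t ht ↦ hγ.concat_of_ge (δ := δ) ht.1.le,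
    integral_deriv_comp_mul_sub ω (hγ.smooth.differentiable (by simp)),
    integral_deriv_comp_mul_sub ω (hδ.smooth.differentiable (by simp))]
  norm_num [lineIntegral]

/-- The periodic extension of a flat loop is smooth. -/
theorem contDiff_fract (h : IsFlatPath B x x γ) :
    ContDiff ℝ (⊤ : ℕ∞) fun t ↦ γ (Int.fract t) := by
  refine contDiff_iff_contDiffAt.2 fun t ↦ ?_
  have hs : ContDiff ℝ (⊤ : ℕ∞) fun s : ℝ ↦ γ (s - ⌊t⌋ + 1) + (γ (s - ⌊t⌋) - x) :=
    (h.smooth.comp (by fun_prop)).add ((h.smooth.comp (by fun_prop)).sub contDiff_const)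
  refine hs.contDiffAt.congr_of_eventuallyEq ?_
  have ht : Ioo ((⌊t⌋ : ℝ) - 1) (⌊t⌋ + 1) ∈ 𝓝 t :=
    isOpen_Ioo.mem_nhds ⟨by linarith [Int.floor_le t], Int.lt_floor_add_one t⟩
  filter_upwards [ht] with s hs
  rcases lt_or_ge s (⌊t⌋ : ℝ) with hlt | hge
  · have hf : ⌊s⌋ = ⌊t⌋ - 1 :=
      Int.floor_eq_iff.2 ⟨by push_cast; linarith [hs.1], by push_cast; linarith⟩
    rw [h.eq_source (s - ⌊t⌋) (by linarith), Int.fract, hf]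
    push_cast
    rw [sub_self, add_zero]
    congr 1
    ring
  · have hf : ⌊s⌋ = ⌊t⌋ := Int.floor_eq_iff.2 ⟨hge, hs.2⟩
    rw [h.eq_target (s - ⌊t⌋ + 1) (by linarith), Int.fract, hf, add_sub_cancel]

theorem lineIntegral_fract (ω : E → E →L[ℝ] ℝ) (γ : ℝ → E) :
    lineIntegral ω (fun t ↦ γ (Int.fract t)) = lineIntegral ω γ :=
  integral_deriv_congr zero_le_one fun t ht ↦ by
    simp only [Int.fract_eq_self.2 ⟨ht.1.le, ht.2⟩]

end IsFlatPath

/-- A locally exact continuous `1`-form on `B` whose integral along every smooth closed curve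
vanishes is exact. -/
theorem exists_primitive_of_lineIntegral_eq_zero {B : Set E} {ω : E → E →L[ℝ] ℝ}
    (hω : ContinuousOn ω B)
    (hloc : ∀ x ∈ B, ∃ r > 0, Metric.ball x r ⊆ B ∧
      ∃ g : E → ℝ, ∀ y ∈ Metric.ball x r, HasFDerivAt g (ω y) y)
    (hcirc : ∀ γ : ℝ → E, ContDiff ℝ (⊤ : ℕ∞) γ → (∀ t, γ (t + 1) = γ t) → (∀ t, γ t ∈ B) →
      lineIntegral ω γ = 0) :
    ∃ f : E → ℝ, ∀ x ∈ B, HasFDerivAt f (ω x) x := by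
  have hloop {x : E} {γ : ℝ → E} (h : IsFlatPath B x x γ) : lineIntegral ω γ = 0 := by
    rw [← IsFlatPath.lineIntegral_fract]
    exact hcirc _ h.contDiff_fract (fun t ↦ by simp) fun t ↦ h.mem _
  have hindep {x y : E} {γ δ : ℝ → E} (hγ : IsFlatPath B x y γ) (hδ : IsFlatPath B x y δ) :
      lineIntegral ω γ = lineIntegral ω δ := by
    have := hloop (hγ.trans hδ.symm)
    rw [hγ.lineIntegral_concat hω hδ.symm, hδ.lineIntegral_symm] at this
    linarith
  let S : Setoid B :=
    { r := fun x y ↦ ∃ γ, IsFlatPath B (x : E) y γ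
      iseqv :=
        { refl := fun x ↦ ⟨_, .segment (by simp)⟩
          symm := fun ⟨_, h⟩ ↦ ⟨_, h.symm⟩
          trans := fun ⟨_, h⟩ ⟨_, h'⟩ ↦ ⟨_, h.trans h'⟩ } }
  let base (x : B) : B := (Quotient.mk S x).out
  choose path hpath using fun x : B ↦ (Quotient.mk_out (s := S) x : S (base x) x)
  classical
  refine ⟨fun x ↦ if hx : x ∈ B then lineIntegral ω (path ⟨x, hx⟩) else 0, fun x hx ↦ ?_⟩
  obtain ⟨r, hr, hrB, g, hg⟩ := hloc x hx
  have hxr : x ∈ Metric.ball x r := Metric.mem_ball_self hr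
  have key : ∀ y ∈ Metric.ball x r,
      (if hy : y ∈ B then lineIntegral ω (path ⟨y, hy⟩) else 0) =
        g y + (lineIntegral ω (path ⟨x, hx⟩) - g x) := by
    intro y hy
    have hyB := hrB hy
    have hseg := IsFlatPath.segment ((convex_ball x r).segment_subset hxr hy)
    have hsegB := IsFlatPath.segment (((convex_ball x r).segment_subset hxr hy).trans hrB)
    have hbase : base ⟨x, hx⟩ = base ⟨y, hyB⟩ :=
      congrArg Quotient.out (Quotient.sound (s := S) ⟨_, hsegB⟩)
    have hpy : IsFlatPath B (base ⟨x, hx⟩ : E) y (path ⟨y, hyB⟩) := hbase ▸ hpath ⟨y, hyB⟩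
    have hsum := hindep hpy ((hpath ⟨x, hx⟩).trans hsegB)
    rw [(hpath ⟨x, hx⟩).lineIntegral_concat hω hsegB,
      lineIntegral_eq_sub (hω.mono hrB) hg hseg.smooth hseg.mem,
      hseg.eq_target 1 le_rfl, hseg.eq_source 0 le_rfl] at hsum
    rw [dif_pos hyB, hsum]
    ring
  refine ((hg x hxr).add_const
    (lineIntegral ω (path ⟨x, hx⟩) - g x)).congr_of_eventuallyEq ?_
  filter_upwards [Metric.ball_mem_nhds x hr] with y hy using key y hy

end FlatPath

section VectorField

variable {n : ℕ}

/-- The `1`-form `∑ I, Y I dx^I` attached to a vector field. -/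
noncomputable def coordForm (Y : (Fin n → ℝ) → Fin n → ℝ) (x : Fin n → ℝ) :
    (Fin n → ℝ) →L[ℝ] ℝ :=
  ∑ I, Y x I • ContinuousLinearMap.proj (R := ℝ) (φ := fun _ : Fin n ↦ ℝ) I

theorem coordForm_apply (Y : (Fin n → ℝ) → Fin n → ℝ) (x v : Fin n → ℝ) :
    coordForm Y x v = ∑ I, Y x I * v I := by
  simp [coordForm]

theorem apply_eq_sum_single (L : (Fin n → ℝ) →L[ℝ] ℝ) (v : Fin n → ℝ) :
    L v = ∑ I, L (Pi.single I 1) * v I := by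
  conv_lhs => rw [pi_eq_sum_univ' v]
  simp only [map_sum, map_smul, smul_eq_mul, mul_comm]

theorem eq_coordForm {Y : (Fin n → ℝ) → Fin n → ℝ} {f : (Fin n → ℝ) → ℝ} {x : Fin n → ℝ}
    (h : ∀ I, Y x I = pd I f x) : fderiv ℝ f x = coordForm Y x := by
  ext1 v
  rw [coordForm_apply, apply_eq_sum_single]
  simp only [h, pd]

theorem contDiffOn_coordForm {B : Set (Fin n → ℝ)} {Y : (Fin n → ℝ) → Fin n → ℝ}
    (hY : ContDiffOn ℝ (⊤ : ℕ∞) Y B) : ContDiffOn ℝ (⊤ : ℕ∞) (coordForm Y) B :=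
  ContDiffOn.sum fun I _ ↦ (contDiffOn_pi.1 hY I).smul contDiffOn_const

theorem fderiv_coordForm_apply {Y : (Fin n → ℝ) → Fin n → ℝ} {x : Fin n → ℝ}
    (hY : DifferentiableAt ℝ Y x) (u v : Fin n → ℝ) :
    fderiv ℝ (coordForm Y) x u v = ∑ I, ∑ J, pd J (fun y ↦ Y y I) x * u J * v I := by
  have h : HasFDerivAt (coordForm Y) (∑ I, (fderiv ℝ (fun y ↦ Y y I) x).smulRight
      (ContinuousLinearMap.proj (R := ℝ) (φ := fun _ : Fin n ↦ ℝ) I)) x :=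
    HasFDerivAt.fun_sum fun I _ ↦
      ((differentiableAt_pi.1 hY I).hasFDerivAt).smul_const
        (ContinuousLinearMap.proj (R := ℝ) (φ := fun _ : Fin n ↦ ℝ) I)
  rw [h.fderiv]
  simp only [sum_apply, ContinuousLinearMap.smulRight_apply,
    smul_apply, ContinuousLinearMap.proj_apply, smul_eq_mul]
  refine Finset.sum_congr rfl fun I _ ↦ ?_
  rw [apply_eq_sum_single, Finset.sum_mul]
  rfl

theorem fderiv_coordForm_symm {Y : (Fin n → ℝ) → Fin n → ℝ} {x : Fin n → ℝ}
    (hY : DifferentiableAt ℝ Y x)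
    (hcurl : ∀ J K, pd J (fun y ↦ Y y K) x = pd K (fun y ↦ Y y J) x) (u v : Fin n → ℝ) :
    fderiv ℝ (coordForm Y) x u v = fderiv ℝ (coordForm Y) x v u := by
  rw [fderiv_coordForm_apply hY, fderiv_coordForm_apply hY, Finset.sum_comm]
  refine Finset.sum_congr rfl fun I _ ↦ Finset.sum_congr rfl fun J _ ↦ ?_
  rw [hcurl]
  ring

theorem pd_symm_of_gradient {B : Set (Fin n → ℝ)} (hB : IsOpen B)
    {Y : (Fin n → ℝ) → Fin n → ℝ} {f : (Fin n → ℝ) → ℝ} (hf : ContDiffOn ℝ (⊤ : ℕ∞) f B)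
    (hYf : ∀ x ∈ B, ∀ I, Y x I = pd I f x) {x : Fin n → ℝ} (hx : x ∈ B) (J K : Fin n) :
    pd J (fun y ↦ Y y K) x = pd K (fun y ↦ Y y J) x := by
  have hfx : ContDiffAt ℝ (⊤ : ℕ∞) f x := hf.contDiffAt (hB.mem_nhds hx)
  have hd : DifferentiableAt ℝ (fderiv ℝ f) x :=
    (((contDiffOn_infty_iff_fderiv_of_isOpen hB).1 hf).2.contDiffAt
      (hB.mem_nhds hx)).differentiableAt (by simp)
  have hpd (J K : Fin n) : pd J (fun y ↦ Y y K) x =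
      fderiv ℝ (fderiv ℝ f) x (Pi.single J 1) (Pi.single K 1) := by
    have h : (fun y ↦ Y y K) =ᶠ[nhds x] fun y ↦ fderiv ℝ f y (Pi.single K 1) := by
      filter_upwards [hB.mem_nhds hx] with y hy using hYf y hy K
    rw [pd, h.fderiv_eq, fderiv_clm_apply hd (by fun_prop)]
    simp
  rw [hpd, hpd]
  exact hfx.isSymmSndFDerivAt (by simpa using WithTop.coe_le_coe.2 (le_top : (2 : ℕ∞) ≤ ⊤)) _ _

end VectorField

/-- A smooth vector field `Y` on an open `B ⊆ ℝ³` is a gradient `Y = grad f` iff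
`curl Y = 0` (i.e. `∂_J Y^K = ∂_K Y^J`) and the circulation of `Y` along every smooth
closed curve in `B` vanishes. -/
theorem gradient_of_function_iff_3d
    (B : Set (Fin 3 → ℝ)) (hB : IsOpen B)
    (Y : (Fin 3 → ℝ) → Fin 3 → ℝ)
    (hY : ContDiffOn ℝ (⊤ : ℕ∞) Y B) :
    (∃ f : (Fin 3 → ℝ) → ℝ,
        ContDiffOn ℝ (⊤ : ℕ∞) f B ∧
        ∀ x ∈ B, ∀ I, Y x I = pd I f x) ↔
      ((∀ x ∈ B, ∀ J K, pd J (fun y => Y y K) x = pd K (fun y => Y y J) x) ∧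
        ∀ γ : ℝ → Fin 3 → ℝ, IsSmoothClosedCurveIn B γ →
          (∫ t in (0:ℝ)..1, ∑ I, Y (γ t) I * deriv γ t I) = 0) := by
  have hω := contDiffOn_coordForm hY
  have hint (γ : ℝ → Fin 3 → ℝ) :
      (∫ t in (0:ℝ)..1, ∑ I, Y (γ t) I * deriv γ t I) = lineIntegral (coordForm Y) γ := by
    simp only [lineIntegral, coordForm_apply]
  simp only [hint]
  constructor
  · rintro ⟨f, hf, hYf⟩
    refine ⟨fun x hx J K ↦ pd_symm_of_gradient hB hf hYf hx J K, fun γ ⟨hγ, hper, hmem⟩ ↦ ?_⟩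
    have hfd (x) (hx : x ∈ B) : HasFDerivAt f (coordForm Y x) x :=
      eq_coordForm (hYf x hx) ▸
        ((hf.contDiffAt (hB.mem_nhds hx)).differentiableAt (by simp)).hasFDerivAt
    rw [lineIntegral_eq_sub hω.continuousOn hfd hγ hmem, ← hper 0, zero_add, sub_self]
  · rintro ⟨hcurl, hcirc⟩
    obtain ⟨f, hf⟩ := exists_primitive_of_lineIntegral_eq_zero hω.continuousOn
      (fun x hx ↦ by
        obtain ⟨r, hr, hrB⟩ := Metric.isOpen_iff.1 hB x hx
        refine ⟨r, hr, hrB, (convex_ball x r).exists_forall_hasFDerivAt_of_fderiv_symmetric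
          Metric.isOpen_ball ((hω.differentiableOn (by simp)).mono hrB) fun y hy ↦ ?_⟩
        exact fderiv_coordForm_symm ((hY.contDiffAt (hB.mem_nhds (hrB hy))).differentiableAt
          (by simp)) (hcurl y (hrB hy)))
      fun γ hγ hper hmem ↦ hcirc γ ⟨hγ, hper, hmem⟩
    refine ⟨f, (contDiffOn_infty_iff_fderiv_of_isOpen hB).2
      ⟨fun x hx ↦ (hf x hx).differentiableAt.differentiableWithinAt,
        hω.congr fun x hx ↦ (hf x hx).fderiv⟩, fun x hx I ↦ ?_⟩
    simp [pd, (hf x hx).fderiv, coordForm_apply, Pi.single_apply]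
end
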